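/- arXiv:1910.08661 — 2 statements merged into one kernel-verified Lean document; each statement's English description precedes it below -/
import Mathlib

section
/- There exists a constant c > 0 such that for every graph H with m ≥ 2 edges and no isolated vertices, letting h = v(H) be its number of vertices, there is an n₀ = n₀(H) such that for all n ≥ n₀, every red/blue coloring of the edges of the complete graph K_n contains at least 2^{−c·m^{4/3}·(log m)²} · C(n, h) monochromatic subgraphs isomorphic to H (i.e. h-vertex subsets carrying a copy of H all of whose edges have the same color). In particular, the 2-color Ramsey multiplicity constant satisfies C₂(H) ≥ 2^{−c·m^{4/3}·(log m)²}. -/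
open scoped Classical in
/-- A two-colouring `χ` of `V × V` in which every colour has density at least `ρ` between any two
sets of at least `δ * |V|` elements. -/
def Nonsparse {V : Type*} [Fintype V] (χ : V → V → Bool) (δ ρ : ℝ) : Prop :=
  ∀ A B : Finset V, δ * Fintype.card V ≤ A.card → δ * Fintype.card V ≤ B.card →
    ∀ c : Bool, ρ * A.card * B.card ≤ ∑ a ∈ A, ((B.filter fun b => χ a b = c).card : ℝ)

open scoped Classical in
theorem Nonsparse.card_low_degree_lt {V : Type*} [Fintype V] {χ : V → V → Bool} {δ ρ : ℝ}
    (hχ : Nonsparse χ δ ρ) (hpos : 0 < δ * Fintype.card V) {B : Finset V}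
    (hB : δ * Fintype.card V ≤ B.card) (c : Bool) :
    (((Finset.univ : Finset V).filter fun x =>
      ((B.filter fun b => χ x b = c).card : ℝ) < ρ * B.card).card : ℝ) < δ * Fintype.card V := by
  by_contra! h
  have h1 := hχ _ B h hB c
  have hne : ((Finset.univ : Finset V).filter fun x =>
      ((B.filter fun b => χ x b = c).card : ℝ) < ρ * B.card).Nonempty := by
    rw [← Finset.card_pos]
    exact_mod_cast hpos.trans_le h
  have h2 := Finset.sum_lt_sum_of_nonempty hne (fun x hx => (Finset.mem_filter.1 hx).2)
  rw [Finset.sum_const, nsmul_eq_mul] at h2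
  nlinarith

theorem mul_le_card_of_le_card_fiber {β V : Type*} [DecidableEq V] {F : Finset β} (p : β → V)
    {X : Finset V}
    {s r : ℝ} (hr : 0 ≤ r) (hX : s ≤ X.card)
    (h : ∀ x ∈ X, r ≤ ((F.filter fun f => p f = x).card : ℝ)) : s * r ≤ F.card :=
  calc s * r ≤ X.card * r := by gcongr
    _ = ∑ x ∈ X, r := by rw [Finset.sum_const, nsmul_eq_mul]
    _ ≤ ∑ x ∈ X, ((F.filter fun f => p f = x).card : ℝ) := Finset.sum_le_sum h
    _ ≤ F.card := by
      rw [← Nat.cast_sum, Nat.cast_le, Finset.sum_card_fiberwise_eq_card_filter]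
      exact Finset.card_filter_le _ _

open scoped Classical in
/-- `Rich s P j l` says that `l` can be extended `j` times, with at least `s` choices of the new
head each time, so that the resulting list satisfies `P`. -/
def Rich {V : Type*} [Fintype V] (s : ℝ) (P : List V → Prop) : ℕ → List V → Prop
  | 0, l => P l
  | j + 1, l => s ≤ (((Finset.univ : Finset V).filter fun x => Rich s P j (x :: l)).card : ℝ)

open scoped Classical in
theorem Rich.pow_le_card {V : Type*} [Fintype V] {s : ℝ} (hs : 0 ≤ s) {P : List V → Prop} :
    ∀ {j : ℕ} {l : List V}, Rich s P j l →
      s ^ j ≤ (((Finset.univ : Finset (Fin j → V)).filter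
        fun g => P (List.ofFn g ++ l)).card : ℝ)
  | 0, l, h => by
    have h' : P l := h
    simp [h']
  | j + 1, l, h => by
    rw [pow_succ']
    refine mul_le_card_of_le_card_fiber (fun g => g (Fin.last j)) (by positivity) h ?_
    intro x hx
    refine (Rich.pow_le_card hs (Finset.mem_filter.1 hx).2).trans ?_
    rw [Nat.cast_le]
    refine Finset.card_le_card_of_injOn
      (fun g : Fin j → V => (Fin.snoc g x : Fin (j + 1) → V)) ?_ ?_
    · intro g hg
      have hg' : P (List.ofFn g ++ x :: l) := by simpa using hg
      have : List.ofFn (Fin.snoc g x : Fin (j + 1) → V) = List.ofFn g ++ [x] := by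
        rw [List.ofFn_succ']
        simp [List.concat_eq_append]
      simp only [Finset.coe_filter, Finset.mem_filter, Finset.mem_univ, true_and,
        Set.mem_ofPred_eq, Fin.snoc_last, and_true]
      rw [this]
      simpa using hg'
    · intro g _ g' _ hgg
      funext i
      have := congrFun hgg (Fin.castSucc i)
      simpa using this

/-- No sublist of `L` is rich. -/
def Clean {V : Type*} [Fintype V] (s : ℝ) (P : List V → Prop) (k : ℕ) (L : List V) : Prop :=
  ∀ (j : ℕ) (l : List V), l.Sublist L → l.length + j = k → ¬ Rich s P j l

theorem clean_nil {V : Type*} [Fintype V] {s : ℝ} {P : List V → Prop} {k : ℕ}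
    (h : ¬ Rich s P k []) : Clean s P k [] := by
  intro j l hl hj
  obtain rfl := List.sublist_nil.1 hl
  simp only [List.length_nil, zero_add] at hj
  rwa [hj]

open scoped Classical in
theorem Clean.card_not_clean_cons_le {V : Type*} [Fintype V] {s : ℝ} {P : List V → Prop} {k : ℕ}
    {L : List V} (hL : Clean s P k L) (hs : 0 ≤ s) {M : ℕ} (hM : 1 ≤ M) (hLM : L.length ≤ M) :
    (((Finset.univ : Finset V).filter fun x => ¬ Clean s P k (x :: L)).card : ℝ)
      ≤ k * M ^ k * s := by
  set I := (Finset.range k).biUnion fun i => (List.sublistsLen i L).toFinset with hI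
  have hIcard : I.card ≤ k * M ^ k := by
    refine (Finset.card_biUnion_le_card_mul _ _ (M ^ k) ?_).trans (by simp)
    intro i hi
    refine (List.toFinset_card_le _).trans ?_
    rw [List.length_sublistsLen]
    refine (Nat.choose_le_pow _ _).trans ?_
    exact (Nat.pow_le_pow_left hLM i).trans
      (Nat.pow_le_pow_right hM (Finset.mem_range.1 hi).le)
  have hsub : ((Finset.univ : Finset V).filter fun x => ¬ Clean s P k (x :: L)) ⊆
      I.biUnion fun l => if l.length < k then
        (Finset.univ : Finset V).filter fun x => Rich s P (k - l.length - 1) (x :: l) else ∅ := by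
    intro x hx
    have hx' := (Finset.mem_filter.1 hx).2
    simp only [Clean, not_forall, not_not] at hx'
    obtain ⟨j, l, hl, hj, hr⟩ := hx'
    rcases List.sublist_cons_iff.1 hl with h | ⟨r, rfl, h⟩
    · exact absurd hr (hL j l h hj)
    · simp only [List.length_cons] at hj
      refine Finset.mem_biUnion.2 ⟨r, ?_, ?_⟩
      · refine Finset.mem_biUnion.2 ⟨r.length, Finset.mem_range.2 (by omega), ?_⟩
        rw [List.mem_toFinset]
        exact List.mem_sublistsLen.2 ⟨h, rfl⟩
      · rw [if_pos (by omega)]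
        have : k - r.length - 1 = j := by omega
        rw [this]
        simpa using hr
  have hcard := (Finset.card_le_card hsub).trans Finset.card_biUnion_le
  have : ∀ l ∈ I, (((if l.length < k then
        (Finset.univ : Finset V).filter fun x => Rich s P (k - l.length - 1) (x :: l)
        else ∅) : Finset V).card : ℝ) ≤ s := by
    intro l hl
    split_ifs with h
    · obtain ⟨i, -, hi⟩ := Finset.mem_biUnion.1 hl
      rw [List.mem_toFinset] at hi
      have h1 := hL (k - l.length - 1 + 1) l (List.mem_sublistsLen.1 hi).1 (by omega)
      exact (not_le.1 h1).le
    · simpa using hs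
  calc (((Finset.univ : Finset V).filter fun x => ¬ Clean s P k (x :: L)).card : ℝ)
      ≤ ∑ l ∈ I, (((if l.length < k then
        (Finset.univ : Finset V).filter fun x => Rich s P (k - l.length - 1) (x :: l)
        else ∅) : Finset V).card : ℝ) := by exact_mod_cast hcard
    _ ≤ ∑ l ∈ I, s := Finset.sum_le_sum this
    _ = I.card * s := by rw [Finset.sum_const, nsmul_eq_mul]
    _ ≤ k * M ^ k * s := by
      gcongr
      exact_mod_cast hIcard

open scoped Classical in
/-- The list `l` is monochromatic of colour `c`, and every set of at most `d` of its elements has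
at least `r` common neighbours of colour `c`. -/
def Good {V : Type*} [Fintype V] (χ : V → V → Bool) (c : Bool) (d : ℕ) (r : ℝ) (l : List V) :
    Prop :=
  l.Pairwise (fun x y => χ x y = c) ∧ ∀ D : Finset V, D ⊆ l.toFinset → D.card ≤ d →
    r ≤ (((Finset.univ : Finset V).filter fun y => ∀ x ∈ D, χ x y = c).card : ℝ)

theorem card_filter_card_le_powerset_le {V : Type*} (X : Finset V) (d : ℕ) :
    (X.powerset.filter fun D => D.card ≤ d).card ≤ (X.card + 1) ^ d := by
  classical
  have hsub : (X.powerset.filter fun D => D.card ≤ d) ⊆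
      (Finset.range (d + 1)).biUnion fun i => X.powersetCard i := by
    intro D hD
    simp only [Finset.mem_filter, Finset.mem_powerset] at hD
    simp only [Finset.mem_biUnion, Finset.mem_range, Finset.mem_powersetCard]
    exact ⟨D.card, by omega, hD.1, rfl⟩
  refine (Finset.card_le_card hsub).trans (Finset.card_biUnion_le.trans ?_)
  rw [add_pow]
  refine Finset.sum_le_sum fun i hi => ?_
  rw [Finset.card_powersetCard, one_pow, mul_one]
  have h1 : 1 ≤ d.choose i := Nat.choose_pos (by simpa [Nat.lt_succ_iff] using hi)
  exact (Nat.choose_le_pow _ _).trans (Nat.le_mul_of_pos_right _ h1)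

open scoped Classical in
theorem length_mul_le_sum_length_filter {V : Type*} [Fintype V] {χ : V → V → Bool} {c : Bool}
    {a : ℝ} : ∀ {X : List V},
      (∀ x ∈ X, a ≤ (((Finset.univ : Finset V).filter fun y => χ x y = c).card : ℝ)) →
      X.length * a ≤ ∑ y, ((X.filter fun x => χ x y = c).length : ℝ)
  | [], _ => by simp
  | x :: X, h => by
    have ih := length_mul_le_sum_length_filter fun y hy => h y (List.mem_cons_of_mem _ hy)
    have hx := h x List.mem_cons_self
    have hsum : ∑ y, (((x :: X).filter fun x => χ x y = c).length : ℝ) =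
        ∑ y, ((if χ x y = c then (1 : ℝ) else 0) +
          ((X.filter fun x => χ x y = c).length : ℝ)) := by
      refine Finset.sum_congr rfl fun y _ => ?_
      by_cases hc : χ x y = c
      · simp [hc, add_comm]
      · simp [hc]
    rw [hsum, Finset.sum_add_distrib, Finset.sum_boole]
    push_cast [List.length_cons]
    linarith

open scoped Classical in
/-- Dependent random choice inside a monochromatic clique whose vertices have large degree. -/
theorem exists_good_sublist {V : Type*} [Fintype V] [Nonempty V] {χ : V → V → Bool} {c : Bool}
    {d k M : ℕ} {r θ : ℝ} {X : List V} (hX : X.Pairwise fun x y => χ x y = c)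
    (hdeg : ∀ x ∈ X, θ * Fintype.card V ≤
      (((Finset.univ : Finset V).filter fun y => χ x y = c).card : ℝ))
    (hlen : (k + 2 : ℝ) ≤ X.length * θ) (hM : X.length ≤ M) (hr0 : 0 ≤ r)
    (hr : M * (M + 1) ^ d * r ≤ Fintype.card V) :
    ∃ l : List V, l.Sublist X ∧ l.length = k ∧ Good χ c d r l := by
  by_contra! hno
  have hN : (0 : ℝ) < Fintype.card V := by exact_mod_cast Fintype.card_pos
  set co : Finset V → Finset V := fun D => Finset.univ.filter fun y => ∀ x ∈ D, χ x y = c with hco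
  set Bad := (X.toFinset.powerset.filter fun D => D.card ≤ d).filter
    fun D => ((co D).card : ℝ) < r with hBad
  have hBadcard : (Bad.card : ℝ) ≤ (M + 1) ^ d := by
    have h1 : Bad.card ≤ (M + 1) ^ d :=
      (Finset.card_filter_le _ _).trans ((card_filter_card_le_powerset_le _ _).trans
        (Nat.pow_le_pow_left (by have := X.toFinset_card_le; omega) _))
    exact_mod_cast h1
  have hpt : ∀ y : V, ((X.filter fun x => χ x y = c).length : ℝ) ≤
      k + ∑ D ∈ Bad, (M : ℝ) * (if y ∈ co D then 1 else 0) := by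
    intro y
    by_contra! hy
    have hnn : 0 ≤ ∑ D ∈ Bad, (M : ℝ) * (if y ∈ co D then 1 else 0) :=
      Finset.sum_nonneg fun D _ => by split_ifs <;> simp
    have hk : k ≤ (X.filter fun x => χ x y = c).length := by
      have : (k : ℝ) < (X.filter fun x => χ x y = c).length := by linarith
      exact_mod_cast this.le
    set l := (X.filter fun x => χ x y = c).take k with hl
    have hls : l.Sublist (X.filter fun x => χ x y = c) := List.take_sublist _ _
    have hlX : l.Sublist X := hls.trans List.filter_sublist
    refine hno l hlX (by simp [hl, hk]) ⟨hX.sublist hlX, fun D hD hDd => ?_⟩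
    by_contra! hlt
    have hDBad : D ∈ Bad := by
      simp only [hBad, Finset.mem_filter, Finset.mem_powerset]
      refine ⟨⟨fun x hx => ?_, hDd⟩, hlt⟩
      exact List.mem_toFinset.2 (hlX.subset (List.mem_toFinset.1 (hD hx)))
    have hyD : y ∈ co D := by
      simp only [hco, Finset.mem_filter, Finset.mem_univ, true_and]
      intro x hx
      have := hls.subset (List.mem_toFinset.1 (hD hx))
      simpa using (List.mem_filter.1 this).2
    have h1 := Finset.single_le_sum
      (f := fun D => (M : ℝ) * (if y ∈ co D then 1 else 0))
      (fun D _ => by split_ifs <;> simp) hDBad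
    simp only [hyD, if_true, mul_one] at h1
    have h2 : ((X.filter fun x => χ x y = c).length : ℝ) ≤ M := by
      exact_mod_cast (List.length_filter_le _ _).trans hM
    have h3 : (0 : ℝ) ≤ k := Nat.cast_nonneg k
    linarith
  have hlow := length_mul_le_sum_length_filter hdeg
  have hup := Finset.sum_le_sum fun y (_ : y ∈ (Finset.univ : Finset V)) => hpt y
  rw [Finset.sum_add_distrib, Finset.sum_comm, Finset.sum_const, nsmul_eq_mul] at hup
  have hin : ∑ D ∈ Bad, ∑ y, (M : ℝ) * (if y ∈ co D then 1 else 0) ≤ ∑ D ∈ Bad, M * r := by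
    refine Finset.sum_le_sum fun D hD => ?_
    rw [← Finset.mul_sum, Finset.sum_boole, Finset.filter_univ_mem]
    gcongr
    exact (Finset.mem_filter.1 hD).2.le
  rw [Finset.sum_const, nsmul_eq_mul] at hin
  have h4 : (Bad.card : ℝ) * (M * r) ≤ Fintype.card V :=
    calc (Bad.card : ℝ) * (M * r) ≤ (M + 1) ^ d * (M * r) := by gcongr
      _ = M * (M + 1) ^ d * r := by ring
      _ ≤ _ := hr
  have h5 : ((Finset.univ : Finset V).card : ℝ) = Fintype.card V := rfl
  rw [h5] at hup
  nlinarith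

open scoped Classical in
/-- Off-diagonal Erdős–Szekeres argument avoiding rich sublists. -/
theorem exists_clean_clique {V : Type*} [Fintype V] {χ : V → V → Bool} {b : Bool}
    {P : Bool → List V → Prop} {k M Mb Mr : ℕ} {s ρ ν : ℝ} {W : Finset V} (hs : 0 ≤ s)
    (hM : 1 ≤ M) (hMb : Mb ≤ M) (hMr : Mr ≤ M) (hρ0 : 0 ≤ ρ) (hρ1 : ρ ≤ 1) (hν : 0 ≤ ν)
    (hsmall : 2 * (k * M ^ k * s) < ν * ρ ^ Mb * (1 - ρ) ^ Mr) :
    ∀ (t : ℕ) (Lb Lr : List V) (U : Finset V), Lb.length + Lr.length + t = Mb + Mr →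
      Lb.length ≤ Mb → Lr.length ≤ Mr → U ⊆ W → (∀ x ∈ Lb, x ∈ W) → (∀ x ∈ Lr, x ∈ W) →
      (Lb.Pairwise fun x y => χ x y = b) → (Lr.Pairwise fun x y => χ x y = !b) →
      (∀ u ∈ U, ∀ x ∈ Lb, χ u x = b) → (∀ u ∈ U, ∀ x ∈ Lr, χ u x = !b) →
      Clean s (P b) k Lb → Clean s (P !b) k Lr →
      ν * ρ ^ Lb.length * (1 - ρ) ^ Lr.length ≤ U.card →
      ∃ (c : Bool) (L : List V), L.length = (if c = b then Mb else Mr) ∧ (∀ x ∈ L, x ∈ W) ∧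
        (L.Pairwise fun x y => χ x y = c) ∧ Clean s (P c) k L := by
  have hρ1' : 0 ≤ 1 - ρ := by linarith
  intro t
  induction t with
  | zero =>
    intro Lb Lr U ht hb hr _ hbW _ hbp _ _ _ hbc _ _
    exact ⟨b, Lb, by simp; omega, hbW, hbp, hbc⟩
  | succ t ih =>
    intro Lb Lr U ht hb hr hUW hbW hrW hbp hrp hbU hrU hbc hrc hU
    rcases hb.eq_or_lt with hb' | hb'
    · exact ⟨b, Lb, by simp [hb'], hbW, hbp, hbc⟩
    rcases hr.eq_or_lt with hr' | hr'
    · exact ⟨!b, Lr, by simp [hr'], hrW, hrp, hrc⟩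
    have hUbig : 2 * (k * M ^ k * s) < U.card := by
      refine hsmall.trans_le (le_trans ?_ hU)
      have e1 : ρ ^ Mb ≤ ρ ^ Lb.length := pow_le_pow_of_le_one hρ0 hρ1 hb
      have e2 : (1 - ρ) ^ Mr ≤ (1 - ρ) ^ Lr.length :=
        pow_le_pow_of_le_one hρ1' (by linarith) hr
      gcongr
    obtain ⟨x, hxU, hxb, hxr⟩ : ∃ x ∈ U, Clean s (P b) k (x :: Lb) ∧
        Clean s (P !b) k (x :: Lr) := by
      by_contra! hno
      have hsub : U ⊆ ((Finset.univ : Finset V).filter fun x => ¬ Clean s (P b) k (x :: Lb)) ∪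
          ((Finset.univ : Finset V).filter fun x => ¬ Clean s (P !b) k (x :: Lr)) := by
        intro x hx
        simp only [Finset.mem_union, Finset.mem_filter, Finset.mem_univ, true_and]
        by_cases h : Clean s (P b) k (x :: Lb)
        · exact Or.inr (hno x hx h)
        · exact Or.inl h
      have h1 := (Finset.card_le_card hsub).trans (Finset.card_union_le _ _)
      have h1' : (U.card : ℝ) ≤
          (((Finset.univ : Finset V).filter fun x => ¬ Clean s (P b) k (x :: Lb)).card : ℝ) +
          (((Finset.univ : Finset V).filter fun x => ¬ Clean s (P !b) k (x :: Lr)).card : ℝ) := by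
        exact_mod_cast h1
      have h2 := hbc.card_not_clean_cons_le hs hM (hb.trans hMb)
      have h3 := hrc.card_not_clean_cons_le hs hM (hr.trans hMr)
      linarith
    have hsplit : ((U.filter fun u => χ u x = b).card : ℝ) +
        ((U.filter fun u => χ u x = !b).card : ℝ) = U.card := by
      rw [← Finset.card_filter_add_card_filter_not (s := U) (fun u => χ u x = b)]
      push_cast
      congr 3
      ext u
      cases χ u x <;> cases b <;> simp
    by_cases hbig : ρ * U.card ≤ ((U.filter fun u => χ u x = b).card : ℝ)
    · refine ih (x :: Lb) Lr (U.filter fun u => χ u x = b) (by simp; omega) hb' hr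
        ((Finset.filter_subset _ _).trans hUW) ?_ hrW ?_ hrp ?_ ?_ hxb hrc ?_
      · simpa using ⟨hUW hxU, hbW⟩
      · exact List.pairwise_cons.2 ⟨hbU x hxU, hbp⟩
      · intro u hu y hy
        obtain ⟨hu1, hu2⟩ := Finset.mem_filter.1 hu
        rcases List.mem_cons.1 hy with rfl | hy
        · exact hu2
        · exact hbU u hu1 y hy
      · exact fun u hu => hrU u (Finset.mem_filter.1 hu).1
      · refine le_trans ?_ hbig
        calc _ = ρ * (ν * ρ ^ Lb.length * (1 - ρ) ^ Lr.length) := by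
              rw [List.length_cons]; ring
          _ ≤ _ := by gcongr
    · refine ih Lb (x :: Lr) (U.filter fun u => χ u x = !b) (by simp; omega) hb hr'
        ((Finset.filter_subset _ _).trans hUW) hbW ?_ hbp ?_ ?_ ?_ hbc hxr ?_
      · simpa using ⟨hUW hxU, hrW⟩
      · exact List.pairwise_cons.2 ⟨hrU x hxU, hrp⟩
      · exact fun u hu => hbU u (Finset.mem_filter.1 hu).1
      · intro u hu y hy
        obtain ⟨hu1, hu2⟩ := Finset.mem_filter.1 hu
        rcases List.mem_cons.1 hy with rfl | hy
        · exact hu2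
        · exact hrU u hu1 y hy
      · have : (1 - ρ) * U.card ≤ ((U.filter fun u => χ u x = !b).card : ℝ) := by linarith
        refine le_trans ?_ this
        calc _ = (1 - ρ) * (ν * ρ ^ Lb.length * (1 - ρ) ^ Lr.length) := by
              rw [List.length_cons]; ring
          _ ≤ _ := by gcongr

open scoped Classical in
theorem Nonsparse.exists_rich {V : Type*} [Fintype V] [Nonempty V] {χ : V → V → Bool} {δ : ℝ}
    {d k q : ℕ} {r s : ℝ} (hq : 2 ≤ q) (hχ : Nonsparse χ δ (1 / q)) (hδ0 : 0 < δ)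
    (hδ : δ ≤ 1 / 4) (hr0 : 0 ≤ r) (hs0 : 0 ≤ s)
    (hr : ((k + 2) * q : ℝ) * ((k + 2) * q + 1) ^ d * r ≤ Fintype.card V)
    (hs : 2 * (k * ((k + 2) * q : ℝ) ^ k * s) <
      Fintype.card V / 4 * (1 / q : ℝ) ^ (2 * (k + 2)) * (1 - 1 / q : ℝ) ^ ((k + 2) * q)) :
    ∃ c, Rich s (Good χ c d r) k [] := by
  have hN : (0 : ℝ) < Fintype.card V := by exact_mod_cast Fintype.card_pos
  have hq' : (2 : ℝ) ≤ q := by exact_mod_cast hq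
  have hρ0 : (0 : ℝ) ≤ 1 / q := by positivity
  have hρ1 : (1 / q : ℝ) ≤ 1 := by
    rw [div_le_one (by linarith)]; linarith
  set deg : Bool → V → ℝ := fun c x =>
    (((Finset.univ : Finset V).filter fun y => χ x y = c).card : ℝ) with hdeg
  have hdegsum : ∀ x, deg true x + deg false x = Fintype.card V := by
    intro x
    simp only [hdeg]
    rw [← Nat.cast_add, Nat.cast_inj]
    have := Finset.card_filter_add_card_filter_not (s := (Finset.univ : Finset V))
      (fun y => χ x y = true)
    simpa using this
  obtain ⟨b, hb⟩ : ∃ b, (Fintype.card V : ℝ) / 2 ≤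
      (((Finset.univ : Finset V).filter fun x => (Fintype.card V : ℝ) / 2 ≤ deg b x).card : ℝ) := by
    by_contra! hno
    have h1 := hno true
    have h2 := hno false
    have hsub : (Finset.univ : Finset V) ⊆
        (Finset.univ.filter fun x => (Fintype.card V : ℝ) / 2 ≤ deg true x) ∪
        (Finset.univ.filter fun x => (Fintype.card V : ℝ) / 2 ≤ deg false x) := by
      intro x _
      simp only [Finset.mem_union, Finset.mem_filter, Finset.mem_univ, true_and]
      by_contra! h
      linarith [hdegsum x]
    have h3 := (Finset.card_le_card hsub).trans (Finset.card_union_le _ _)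
    rw [Finset.card_univ, ← Nat.cast_le (α := ℝ), Nat.cast_add] at h3
    linarith
  set W := (Finset.univ : Finset V).filter fun x => (Fintype.card V : ℝ) / 2 ≤ deg b x ∧
    (1 / q : ℝ) * Fintype.card V ≤ deg (!b) x with hW
  have hWcard : (Fintype.card V : ℝ) / 4 ≤ W.card := by
    have hlow := hχ.card_low_degree_lt (by positivity) (B := Finset.univ)
      (by rw [Finset.card_univ]; nlinarith) (!b)
    have hsub : (Finset.univ.filter fun x => (Fintype.card V : ℝ) / 2 ≤ deg b x) ⊆
        W ∪ ((Finset.univ : Finset V).filter fun x =>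
          (((Finset.univ : Finset V).filter fun y => χ x y = !b).card : ℝ) <
            1 / q * (Finset.univ : Finset V).card) := by
      intro x hx
      simp only [Finset.mem_filter, Finset.mem_univ, true_and] at hx
      simp only [hW, Finset.mem_union, Finset.mem_filter, Finset.mem_univ, true_and]
      by_cases h : (1 / q : ℝ) * Fintype.card V ≤ deg (!b) x
      · exact Or.inl ⟨hx, h⟩
      · exact Or.inr (not_le.1 h)
    have h3 := (Finset.card_le_card hsub).trans (Finset.card_union_le _ _)
    rw [← Nat.cast_le (α := ℝ), Nat.cast_add] at h3
    nlinarith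
  by_contra! hno
  have hMb : 2 * (k + 2) ≤ (k + 2) * q := by nlinarith
  obtain ⟨c, L, hLlen, hLW, hLp, hLc⟩ := exists_clean_clique (b := b) (χ := χ)
    (P := fun c => Good χ c d r) (k := k) (M := (k + 2) * q) (Mb := 2 * (k + 2))
    (Mr := (k + 2) * q) (ν := Fintype.card V / 4) (W := W) hs0 (by nlinarith) hMb le_rfl hρ0 hρ1
    (by positivity) (by push_cast; exact hs) (2 * (k + 2) + (k + 2) * q) [] [] W
    (by simp) (by simp) (by simp) subset_rfl (by simp) (by simp) (by simp) (by simp) (by simp)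
    (by simp) (clean_nil (hno _)) (clean_nil (hno _)) (by simpa using hWcard)
  have hLM : L.length ≤ (k + 2) * q := by rw [hLlen]; split_ifs <;> omega
  obtain ⟨l, hl, hlk, hgood⟩ := exists_good_sublist (d := d) (k := k) (M := (k + 2) * q) (r := r)
    (θ := if c = b then 1 / 2 else 1 / q) hLp
    (by
      intro x hx
      obtain ⟨-, h1, h2⟩ := Finset.mem_filter.1 (hLW x hx)
      split_ifs with hcb
      · rw [hcb]
        change _ ≤ deg b x
        linarith
      · have : c = !b := by cases c <;> cases b <;> simp_all
        rw [this]
        exact h2)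
    (by
      rw [hLlen]
      split_ifs
      · push_cast; linarith
      · push_cast
        rw [mul_one_div, mul_div_assoc, div_self (by positivity), mul_one])
    hLM hr0 (by push_cast; exact hr)
  exact hLc 0 l hl (by omega) hgood

open scoped Classical in
/-- Greedy extension of a partial monochromatic homomorphism to vertices of small degree. -/
theorem Nonsparse.pow_le_card_extensions {V α : Type*} [Fintype V] [Fintype α]
    {χ : V → V → Bool} (hsymm : ∀ x y, χ x y = χ y x) {δ ρ δ₁ : ℝ} (hχ : Nonsparse χ δ ρ)
    (hpos : 0 < δ * Fintype.card V) (hρ0 : 0 < ρ) (hρ1 : ρ ≤ 1) (hδ₁ : 0 ≤ δ₁)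
    {H : SimpleGraph α} {d : ℕ} (hδ : (d + 1) * δ ≤ δ₁ * ρ ^ d) (c : Bool) :
    ∀ (t : ℕ) (T : Finset α) (f : α → V), Tᶜ.card = t →
      (∀ v ∉ T, (Finset.univ.filter fun u => H.Adj u v).card ≤ d) →
      (∀ u ∈ T, ∀ v ∈ T, H.Adj u v → χ (f u) (f v) = c) →
      (∀ v ∉ T, δ₁ * ρ ^ (T.filter fun u => H.Adj u v).card * Fintype.card V ≤
        (((Finset.univ : Finset V).filter fun x => ∀ u ∈ T, H.Adj u v → χ (f u) x = c).card : ℝ)) →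
      (δ * Fintype.card V) ^ t ≤ (((Finset.univ : Finset (α → V)).filter fun g =>
        (∀ u ∈ T, g u = f u) ∧ ∀ u v, H.Adj u v → χ (g u) (g v) = c).card : ℝ) := by
  intro t
  induction t with
  | zero =>
    intro T f hT _ hf _
    have hT' : ∀ v, v ∈ T := by
      intro v
      by_contra hv
      have := Finset.card_pos.2 ⟨v, Finset.mem_compl.2 hv⟩
      omega
    rw [pow_zero, Nat.one_le_cast, Nat.one_le_iff_ne_zero, Finset.card_ne_zero]
    exact ⟨f, by simpa using fun u v => hf u (hT' u) v (hT' v)⟩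
  | succ t ih =>
    intro T f hT hd hf hC
    obtain ⟨v, hv⟩ : Tᶜ.Nonempty := by rw [← Finset.card_pos]; omega
    rw [Finset.mem_compl] at hv
    set C : α → Finset V := fun w =>
      (Finset.univ : Finset V).filter fun x => ∀ u ∈ T, H.Adj u w → χ (f u) x = c with hCdef
    have hCbig : ∀ w ∉ T, (d + 1) * (δ * Fintype.card V) ≤ (C w).card := by
      intro w hw
      refine le_trans ?_ (hC w hw)
      have h1 : (T.filter fun u => H.Adj u w).card ≤ d :=
        (Finset.card_le_card (Finset.filter_subset_filter _ (Finset.subset_univ _))).trans (hd w hw)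
      have h2 : ρ ^ d ≤ ρ ^ (T.filter fun u => H.Adj u w).card :=
        pow_le_pow_of_le_one hρ0.le hρ1 h1
      calc (d + 1) * (δ * Fintype.card V) = ((d + 1) * δ) * Fintype.card V := by ring
        _ ≤ (δ₁ * ρ ^ d) * Fintype.card V := by gcongr
        _ ≤ _ := by gcongr
    have hCbig' : ∀ w ∉ T, δ * Fintype.card V ≤ (C w).card := by
      intro w hw
      refine le_trans ?_ (hCbig w hw)
      have : (0 : ℝ) ≤ d := Nat.cast_nonneg d
      nlinarith
    set B : α → Finset V := fun w => (Finset.univ : Finset V).filter fun x =>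
      (((C w).filter fun z => χ x z = c).card : ℝ) < ρ * (C w).card with hB
    set Nb : Finset α := (Finset.univ.filter fun u => H.Adj u v).filter fun u => u ∉ T with hNb
    set X := C v \ Nb.biUnion B with hX
    have hXcard : δ * Fintype.card V ≤ X.card := by
      have h1 : ((Nb.biUnion B).card : ℝ) ≤ d * (δ * Fintype.card V) := by
        calc ((Nb.biUnion B).card : ℝ) ≤ ∑ w ∈ Nb, ((B w).card : ℝ) := by
              exact_mod_cast Finset.card_biUnion_le
          _ ≤ ∑ w ∈ Nb, δ * Fintype.card V := Finset.sum_le_sum fun w hw =>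
              (hχ.card_low_degree_lt hpos (hCbig' w (Finset.mem_filter.1 hw).2) c).le
          _ = Nb.card * (δ * Fintype.card V) := by rw [Finset.sum_const, nsmul_eq_mul]
          _ ≤ _ := by
            gcongr
            exact (Finset.card_filter_le _ _).trans (hd v hv)
      have h2 := Finset.le_card_sdiff (Nb.biUnion B) (C v)
      have h2' : ((C v).card : ℝ) ≤ X.card + (Nb.biUnion B).card := by
        exact_mod_cast Nat.sub_le_iff_le_add.1 h2
      linarith [hCbig v hv]
    rw [pow_succ']
    refine mul_le_card_of_le_card_fiber (fun g => g v) (by positivity) hXcard fun x hx => ?_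
    obtain ⟨hxC, hxB⟩ := Finset.mem_sdiff.1 hx
    have hxC' : ∀ u ∈ T, H.Adj u v → χ (f u) x = c := by simpa [hCdef] using hxC
    have hne : ∀ u ∈ T, u ≠ v := fun u hu h => hv (h ▸ hu)
    have key := ih (insert v T) (Function.update f v x)
      (by rw [Finset.compl_insert, Finset.card_erase_of_mem (Finset.mem_compl.2 hv)]; omega)
      (fun w hw => hd w fun h => hw (Finset.mem_insert_of_mem h))
      (by
        intro u hu w hw huw
        rcases Finset.mem_insert.1 hu with hu' | hu' <;> rcases Finset.mem_insert.1 hw with hw' | hw'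
        · exact absurd (hu'.trans hw'.symm) huw.ne
        · rw [hu', Function.update_self, Function.update_of_ne (hne w hw'), hsymm]
          exact hxC' w hw' (hu' ▸ huw.symm)
        · rw [hw', Function.update_self, Function.update_of_ne (hne u hu')]
          exact hxC' u hu' (hw' ▸ huw)
        · rw [Function.update_of_ne (hne w hw'), Function.update_of_ne (hne u hu')]
          exact hf u hu' w hw' huw)
      (by
        intro w hw
        have hwT : w ∉ T := fun h => hw (Finset.mem_insert_of_mem h)
        have hset : ((Finset.univ : Finset V).filter fun z => ∀ u ∈ insert v T, H.Adj u w →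
            χ (Function.update f v x u) z = c) =
            (C w).filter fun z => H.Adj v w → χ x z = c := by
          ext z
          simp only [hCdef, Finset.mem_filter, Finset.mem_univ, true_and,
            Finset.forall_mem_insert, Function.update_self]
          constructor
          · rintro ⟨h1, h2⟩
            exact ⟨fun u hu => by simpa [Function.update_of_ne (hne u hu)] using h2 u hu, h1⟩
          · rintro ⟨h1, h2⟩
            exact ⟨h2, fun u hu => by simpa [Function.update_of_ne (hne u hu)] using h1 u hu⟩
        rw [hset]
        by_cases hvw : H.Adj v w
        · rw [Finset.filter_insert, if_pos hvw, Finset.card_insert_of_notMem (by simp [hv])]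
          have h1 : x ∉ B w := fun h => hxB (Finset.mem_biUnion.2
            ⟨w, by simp [hNb, hwT, hvw.symm], h⟩)
          have h2 : ρ * (C w).card ≤ (((C w).filter fun z => χ x z = c).card : ℝ) := by
            simpa [hB] using h1
          simp only [hvw, true_implies]
          refine le_trans ?_ h2
          calc _ = ρ * (δ₁ * ρ ^ (T.filter fun u => H.Adj u w).card * Fintype.card V) := by
                rw [pow_succ]; ring
            _ ≤ _ := mul_le_mul_of_nonneg_left (hC w hwT) hρ0.le
        · rw [Finset.filter_insert, if_neg hvw]
          simpa [hvw] using hC w hwT)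
    refine key.trans ?_
    rw [Nat.cast_le]
    refine Finset.card_le_card fun g hg => ?_
    simp only [Finset.mem_filter, Finset.mem_univ, true_and, Finset.forall_mem_insert,
      Function.update_self] at hg ⊢
    obtain ⟨⟨h1, h2⟩, h3⟩ := hg
    exact ⟨⟨fun u hu => by rw [h2 u hu, Function.update_of_ne (hne u hu)], h3⟩, h1⟩

open scoped Classical in
theorem Nonsparse.exists_le_card_hom {V α : Type*} [Fintype V] [Nonempty V] [Fintype α]
    {χ : V → V → Bool} (hsymm : ∀ x y, χ x y = χ y x) {δ δ₁ μ : ℝ} {d q : ℕ}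
    {H : SimpleGraph α} {T : Finset α}
    (hT : ∀ v ∉ T, (Finset.univ.filter fun u => H.Adj u v).card ≤ d)
    (hq : 2 ≤ q) (hχ : Nonsparse χ δ (1 / q)) (hδ0 : 0 < δ)
    (hδ : δ ≤ 1 / 4) (hδ₁ : 0 ≤ δ₁) (hμ : 0 ≤ μ)
    (h₁ : ((T.card + 2) * q : ℝ) * ((T.card + 2) * q + 1) ^ d * δ₁ ≤ 1)
    (h₂ : 2 * (T.card * ((T.card + 2) * q : ℝ) ^ T.card * μ) <
      1 / 4 * (1 / q : ℝ) ^ (2 * (T.card + 2)) * (1 - 1 / q : ℝ) ^ ((T.card + 2) * q))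
    (h₃ : (d + 1) * δ ≤ δ₁ * (1 / q : ℝ) ^ d) :
    ∃ c, (μ * Fintype.card V) ^ T.card * (δ * Fintype.card V) ^ Tᶜ.card ≤
      (((Finset.univ : Finset (α → V)).filter fun g =>
        ∀ u v, H.Adj u v → χ (g u) (g v) = c).card : ℝ) := by
  have hN : (0 : ℝ) < Fintype.card V := by exact_mod_cast Fintype.card_pos
  have hq' : (2 : ℝ) ≤ q := by exact_mod_cast hq
  have hρ0 : (0 : ℝ) < 1 / q := by positivity
  have hρ1 : (1 / q : ℝ) ≤ 1 := by
    rw [div_le_one (by linarith)]; linarith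
  obtain ⟨c, hc⟩ := hχ.exists_rich (d := d) (k := T.card) (r := δ₁ * Fintype.card V)
    (s := μ * Fintype.card V) hq hδ0 hδ (by positivity) (by positivity)
    (by
      calc _ = ((T.card + 2) * q : ℝ) * ((T.card + 2) * q + 1) ^ d * δ₁ * Fintype.card V := by ring
        _ ≤ 1 * Fintype.card V := by gcongr
        _ = _ := one_mul _)
    (by
      have := mul_lt_mul_of_pos_right h₂ hN
      calc _ = 2 * (T.card * ((T.card + 2) * q : ℝ) ^ T.card * μ) * Fintype.card V := by ring
        _ < _ := this
        _ = _ := by ring)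
  refine ⟨c, ?_⟩
  set e := T.equivFin with he
  refine mul_le_card_of_le_card_fiber (fun (f : α → V) (i : Fin T.card) => f (e.symm i))
    (by positivity) (hc.pow_le_card (by positivity)) fun g hg => ?_
  obtain ⟨hpw, hcod⟩ : Good χ c d (δ₁ * Fintype.card V) (List.ofFn g) := by simpa using hg
  rw [List.pairwise_ofFn] at hpw
  set f : α → V := fun u => if h : u ∈ T then g (e ⟨u, h⟩) else Classical.arbitrary V with hf
  have hfT : ∀ (u : α) (h : u ∈ T), f u = g (e ⟨u, h⟩) := fun u h => dif_pos h
  have key := hχ.pow_le_card_extensions hsymm (by positivity) hρ0 hρ1 hδ₁ (H := H) h₃ c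
    Tᶜ.card T f rfl hT
    (by
      intro u hu v hv huv
      rw [hfT u hu, hfT v hv]
      have hne : e ⟨u, hu⟩ ≠ e ⟨v, hv⟩ := by
        intro h
        exact huv.ne (by simpa using e.injective h)
      rcases hne.lt_or_gt with h | h
      · exact hpw h
      · rw [hsymm]; exact hpw h)
    (by
      intro v hv
      have h1 := hcod ((T.filter fun u => H.Adj u v).image f)
        (by
          intro x hx
          obtain ⟨u, hu, rfl⟩ := Finset.mem_image.1 hx
          rw [hfT u (Finset.mem_filter.1 hu).1, List.mem_toFinset]
          simp)
        (Finset.card_image_le.trans ((Finset.card_le_card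
          (Finset.filter_subset_filter _ (Finset.subset_univ _))).trans (hT v hv)))
      have h2 : (1 / q : ℝ) ^ (T.filter fun u => H.Adj u v).card ≤ 1 := pow_le_one₀ hρ0.le hρ1
      calc δ₁ * (1 / q : ℝ) ^ (T.filter fun u => H.Adj u v).card * Fintype.card V
          ≤ δ₁ * 1 * Fintype.card V := by gcongr
        _ = δ₁ * Fintype.card V := by ring
        _ ≤ _ := h1
        _ = _ := by
          congr 2
          ext x
          simp only [Finset.mem_filter, Finset.mem_univ, true_and, Finset.forall_mem_image,
            and_imp])
  refine key.trans ?_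
  rw [Nat.cast_le]
  refine Finset.card_le_card fun f' hf' => ?_
  simp only [Finset.mem_filter, Finset.mem_univ, true_and] at hf' ⊢
  refine ⟨hf'.2, funext fun i => ?_⟩
  rw [hf'.1 _ (e.symm i).2, hfT _ (e.symm i).2]
  simp

open scoped Classical in
/-- A list of subsets of `S`, each with at least `s` elements, such that the density of the pairs
which do not have colour `c` is at most `β` between any two of them. -/
def DenseFamily {V : Type*} (χ : V → V → Bool) (c : Bool) (β s : ℝ) (S : Finset V)
    (L : List (Finset V)) : Prop :=
  (∀ A ∈ L, A ⊆ S ∧ s ≤ A.card) ∧ L.Pairwise fun A B =>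
    ∑ a ∈ A, ((B.filter fun b => χ a b = !c).card : ℝ) ≤ β * A.card * B.card

theorem DenseFamily.mono {V : Type*} {χ : V → V → Bool} {c : Bool} {β s : ℝ} {S S' : Finset V}
    {L : List (Finset V)} (h : DenseFamily χ c β s S L) (hS : S ⊆ S') :
    DenseFamily χ c β s S' L :=
  ⟨fun A hA => ⟨(h.1 A hA).1.trans hS, (h.1 A hA).2⟩, h.2⟩

theorem card_filter_le_mul_of_sum_le {V : Type*} {A : Finset V} {f : V → ℝ} {a b : ℝ}
    (hf : ∀ x ∈ A, 0 ≤ f x) (h : ∑ x ∈ A, f x ≤ b) :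
    ((A.filter fun x => a < f x).card : ℝ) * a ≤ b := by
  rw [← nsmul_eq_mul]
  refine (Finset.card_nsmul_le_sum _ _ _ fun x hx => (Finset.mem_filter.1 hx).2.le).trans ?_
  exact (Finset.sum_le_sum_of_subset_of_nonneg (Finset.filter_subset _ _)
    fun x hx _ => hf x hx).trans h

open scoped Classical in
/-- If all large sets contain sparse pairs, then large sets contain large families of sets which
are pairwise almost monochromatic. -/
theorem exists_denseFamily {V : Type*} {χ : V → V → Bool} {δ ρ s : ℝ} (hs : 0 < s)
    (hδ0 : 0 < δ) (hδ1 : δ ≤ 1) (hρ : 0 < ρ)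
    (hsparse : ∀ S : Finset V, s ≤ S.card → ∃ A ⊆ S, ∃ B ⊆ S, δ * S.card ≤ A.card ∧
      δ * S.card ≤ B.card ∧ ∃ c, ∑ a ∈ A, ((B.filter fun b => χ a b = c).card : ℝ) ≤
        ρ * A.card * B.card) {T : ℕ} :
    ∀ t ≤ T, ∀ S : Finset V, (2 / δ) ^ t * s ≤ S.card →
      ∃ L : Bool → List (Finset V), 2 ^ t ≤ (L true).length * (L false).length ∧
        ∀ c, (L c).length ≤ 2 ^ t ∧ DenseFamily χ c (4 * 2 ^ T * ρ) s S (L c) := by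
  intro t
  induction t with
  | zero =>
    intro _ S hS
    refine ⟨fun _ => [S], by simp, fun c => ⟨by simp, ?_, by simp⟩⟩
    simpa using hS
  | succ t ih =>
    intro ht S hS
    have h2δ : 1 ≤ 2 / δ := by rw [le_div_iff₀ hδ0]; linarith
    have hsS : s ≤ S.card := by
      refine le_trans ?_ hS
      exact le_mul_of_one_le_left hs.le (one_le_pow₀ h2δ)
    obtain ⟨A, hAS, B, hBS, hA, hB, c, hc⟩ := hsparse S hsS
    have hhalf : ∀ A : Finset V, δ * S.card ≤ A.card → ∀ A' : Finset V,
        (A.card : ℝ) ≤ 2 * A'.card → (2 / δ) ^ t * s ≤ A'.card := by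
      intro A hA A' hA'
      have : (2 / δ) ^ t * s * (2 / δ) ≤ S.card := by
        rw [pow_succ] at hS; linarith
      rw [← mul_div_assoc, div_le_iff₀ hδ0] at this
      linarith
    have hSpos : (0 : ℝ) < S.card := hs.trans_le hsS
    have hApos : (0 : ℝ) < A.card := (by positivity : (0 : ℝ) < δ * S.card).trans_le hA
    have hBpos : (0 : ℝ) < B.card := (by positivity : (0 : ℝ) < δ * S.card).trans_le hB
    set A₁ := A.filter fun a => ((B.filter fun b => χ a b = c).card : ℝ) ≤ 2 * ρ * B.card with hA₁
    have hA₁card : (A.card : ℝ) ≤ 2 * A₁.card := by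
      have h1 := card_filter_le_mul_of_sum_le (a := 2 * ρ * B.card)
        (fun x _ => Nat.cast_nonneg _) hc
      have h2 := Finset.card_filter_add_card_filter_not (s := A)
        (fun a => ((B.filter fun b => χ a b = c).card : ℝ) ≤ 2 * ρ * B.card)
      simp only [not_le] at h2
      rw [← hA₁, ← Nat.cast_inj (R := ℝ), Nat.cast_add] at h2
      have h3 : ((A.filter fun a => 2 * ρ * B.card <
          ((B.filter fun b => χ a b = c).card : ℝ)).card : ℝ) * 2 ≤ A.card := by
        refine le_of_mul_le_mul_right ?_ (by positivity : 0 < ρ * B.card)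
        linarith
      linarith
    obtain ⟨L₁, hL₁, hL₁'⟩ := ih (by omega) A₁ (hhalf A hA A₁ hA₁card)
    set B₁ := B.filter fun b => ∀ X ∈ (L₁ (!c)).toFinset,
      ((X.filter fun a => χ a b = c).card : ℝ) ≤ 4 * 2 ^ t * ρ * X.card with hB₁
    have hB₁card : (B.card : ℝ) ≤ 2 * B₁.card := by
      have hbad : ∀ X ∈ (L₁ (!c)).toFinset, ((B.filter fun b => 4 * 2 ^ t * ρ * X.card <
          ((X.filter fun a => χ a b = c).card : ℝ)).card : ℝ) ≤ B.card / (2 * 2 ^ t) := by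
        intro X hX
        obtain ⟨hXA, hXs⟩ := (hL₁' (!c)).2.1 X (List.mem_toFinset.1 hX)
        have hXpos : (0 : ℝ) < X.card := hs.trans_le hXs
        have h1 : ∑ b ∈ B, ((X.filter fun a => χ a b = c).card : ℝ) ≤
            X.card * (2 * ρ * B.card) := by
          have := Finset.sum_card_bipartiteAbove_eq_sum_card_bipartiteBelow (s := X) (t := B)
            (fun a b => χ a b = c)
          simp only [Finset.bipartiteAbove, Finset.bipartiteBelow] at this
          rw [← Nat.cast_sum, ← this, Nat.cast_sum, ← nsmul_eq_mul]
          exact Finset.sum_le_card_nsmul _ _ _ fun a ha => (Finset.mem_filter.1 (hXA ha)).2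
        have h2 := card_filter_le_mul_of_sum_le (a := 4 * 2 ^ t * ρ * X.card)
          (fun x _ => Nat.cast_nonneg _) h1
        rw [le_div_iff₀ (by positivity)]
        refine le_of_mul_le_mul_right ?_ (by positivity : 0 < 2 * ρ * X.card)
        linarith
      have hsub : B ⊆ B₁ ∪ (L₁ (!c)).toFinset.biUnion fun X => B.filter fun b =>
          4 * 2 ^ t * ρ * X.card < ((X.filter fun a => χ a b = c).card : ℝ) := by
        intro b hb
        simp only [hB₁, Finset.mem_union, Finset.mem_filter, Finset.mem_biUnion, hb, true_and]
        by_contra! h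
        exact absurd (h.2) (by simpa using h.1)
      have h3 := (Finset.card_le_card hsub).trans ((Finset.card_union_le _ _).trans
        (Nat.add_le_add_left Finset.card_biUnion_le _))
      rw [← Nat.cast_le (α := ℝ), Nat.cast_add, Nat.cast_sum] at h3
      have h4 := Finset.sum_le_sum hbad
      rw [Finset.sum_const, nsmul_eq_mul] at h4
      have h5 : ((L₁ (!c)).toFinset.card : ℝ) ≤ 2 ^ t := by
        exact_mod_cast (List.toFinset_card_le _).trans (hL₁' (!c)).1
      have h6 : ((L₁ (!c)).toFinset.card : ℝ) * (B.card / (2 * 2 ^ t)) ≤ B.card / 2 := by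
        calc _ ≤ (2 : ℝ) ^ t * (B.card / (2 * 2 ^ t)) := by gcongr
          _ = _ := by field_simp
      linarith
    obtain ⟨L₂, hL₂, hL₂'⟩ := ih (by omega) B₁ (hhalf B hB B₁ hB₁card)
    have hA₁S : A₁ ⊆ S := (Finset.filter_subset _ _).trans hAS
    have hB₁S : B₁ ⊆ S := (Finset.filter_subset _ _).trans hBS
    have hcross : ∀ X ∈ L₁ (!c), ∀ Y ∈ L₂ (!c),
        ∑ a ∈ X, ((Y.filter fun b => χ a b = !!c).card : ℝ) ≤
          4 * 2 ^ T * ρ * X.card * Y.card := by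
      intro X hX Y hY
      have := Finset.sum_card_bipartiteAbove_eq_sum_card_bipartiteBelow (s := X) (t := Y)
        (fun a b => χ a b = c)
      simp only [Finset.bipartiteAbove, Finset.bipartiteBelow] at this
      rw [Bool.not_not, ← Nat.cast_sum, this, Nat.cast_sum]
      refine (Finset.sum_le_card_nsmul _ _ _ fun b hb =>
        (Finset.mem_filter.1 (((hL₂' (!c)).2.1 Y hY).1 hb)).2 X (List.mem_toFinset.2 hX)).trans ?_
      rw [nsmul_eq_mul]
      have : (2 : ℝ) ^ t ≤ 2 ^ T := pow_le_pow_right₀ (by norm_num) (by omega)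
      calc (Y.card : ℝ) * (4 * 2 ^ t * ρ * X.card) ≤ Y.card * (4 * 2 ^ T * ρ * X.card) := by gcongr
        _ = _ := by ring
    have hlen : ∀ (L : Bool → List (Finset V)),
        (L true).length * (L false).length = (L (!c)).length * (L c).length := by
      intro L; cases c
      · rfl
      · exact mul_comm _ _
    rw [hlen] at hL₁ hL₂
    refine ⟨fun c' => if c' = c then
        (if (L₁ c).length ≤ (L₂ c).length then L₂ c else L₁ c)
      else L₁ (!c) ++ L₂ (!c), ?_, fun c' => ?_⟩
    · refine le_of_le_of_eq ?_ (hlen fun c' => if c' = c then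
        (if (L₁ c).length ≤ (L₂ c).length then L₂ c else L₁ c)
        else L₁ (!c) ++ L₂ (!c)).symm
      simp only [Bool.not_eq_self, if_false, if_true, List.length_append, pow_succ]
      split_ifs <;> nlinarith
    · have hpow : 2 ^ t ≤ 2 ^ (t + 1) := Nat.pow_le_pow_right (by norm_num) (by omega)
      by_cases hcc : c' = c
      · subst hcc
        simp only [if_true]
        split_ifs
        · exact ⟨(hL₂' _).1.trans hpow, (hL₂' _).2.mono hB₁S⟩
        · exact ⟨(hL₁' _).1.trans hpow, (hL₁' _).2.mono hA₁S⟩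
      · obtain rfl : c' = !c := by cases c' <;> cases c <;> simp_all
        simp only [hcc, if_false]
        refine ⟨?_, ?_, ?_⟩
        · have h1 := (hL₁' (!c)).1
          have h2 := (hL₂' (!c)).1
          rw [List.length_append, pow_succ]
          omega
        · intro X hX
          rcases List.mem_append.1 hX with hX | hX
          · exact ((hL₁' (!c)).2.mono hA₁S).1 X hX
          · exact ((hL₂' (!c)).2.mono hB₁S).1 X hX
        · exact List.pairwise_append.2 ⟨(hL₁' (!c)).2.2, (hL₂' (!c)).2.2, hcross⟩

open scoped Classical in
theorem card_piFinset_filter_le {V ι : Type*} [Fintype ι] {L : ι → Finset V} {i j : ι}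
    (hij : i ≠ j) {R : V → V → Prop} {β : ℝ}
    (h : ∑ a ∈ L i, (((L j).filter fun b => R a b).card : ℝ) ≤ β * (L i).card * (L j).card) :
    (((Fintype.piFinset L).filter fun g => R (g i) (g j)).card : ℝ) ≤
      β * ∏ l, ((L l).card : ℝ) := by
  set E : ℕ := ∏ l, if l = i then 1 else if l = j then 1 else (L l).card with hE
  have hprod : ∏ l, (L l).card = (L i).card * (L j).card * E := by
    have : ∀ l, (L l).card = (if l = i then (L i).card else 1) *
        (if l = j then (L j).card else 1) *
        (if l = i then 1 else if l = j then 1 else (L l).card) := by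
      intro l
      by_cases hi : l = i
      · subst hi; simp [hij]
      · by_cases hj : l = j
        · subst hj; simp [hi]
        · simp [hi, hj]
    rw [Finset.prod_congr rfl fun l _ => this l, Finset.prod_mul_distrib,
      Finset.prod_mul_distrib, Finset.prod_ite_eq', Finset.prod_ite_eq']
    simp [hE]
  have hfib : ∀ a b, (((Fintype.piFinset L).filter fun g => R (g i) (g j)).filter
      fun g => (g i, g j) = (a, b)).card ≤ E := by
    intro a b
    have hsub : (((Fintype.piFinset L).filter fun g => R (g i) (g j)).filter
        fun g => (g i, g j) = (a, b)) ⊆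
        Fintype.piFinset fun l => if l = i then {a} else if l = j then {b} else L l := by
      intro g hg
      simp only [Finset.mem_filter, Fintype.mem_piFinset, Prod.mk.injEq] at hg
      obtain ⟨⟨h1, -⟩, h2, h3⟩ := hg
      rw [Fintype.mem_piFinset]
      intro l
      split_ifs with hi hj
      · simp [hi, h2]
      · simp [hj, h3]
      · exact h1 l
    refine (Finset.card_le_card hsub).trans ?_
    rw [Fintype.card_piFinset, hE]
    refine Finset.prod_le_prod' fun l _ => ?_
    split_ifs <;> simp
  have hcount : ((Fintype.piFinset L).filter fun g => R (g i) (g j)).card ≤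
      (∑ a ∈ L i, ((L j).filter fun b => R a b).card) * E := by
    have hmem : ∀ g ∈ (Fintype.piFinset L).filter fun g => R (g i) (g j),
        (g i, g j) ∈ (L i ×ˢ L j).filter fun p => R p.1 p.2 := by
      intro g hg
      obtain ⟨h1, h2⟩ := Finset.mem_filter.1 hg
      rw [Fintype.mem_piFinset] at h1
      exact Finset.mem_filter.2 ⟨Finset.mem_product.2 ⟨h1 i, h1 j⟩, h2⟩
    rw [Finset.card_eq_sum_card_fiberwise (f := fun g : ι → V => (g i, g j)) hmem]
    refine (Finset.sum_le_card_nsmul _ _ E fun x _ => hfib x.1 x.2).trans (le_of_eq ?_)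
    rw [smul_eq_mul, Finset.card_filter, Finset.sum_product]
    simp only [Finset.card_filter]
  rw [← Nat.cast_le (α := ℝ), Nat.cast_mul, Nat.cast_sum] at hcount
  rw [← Nat.cast_prod, hprod, Nat.cast_mul, Nat.cast_mul]
  calc _ ≤ (∑ a ∈ L i, (((L j).filter fun b => R a b).card : ℝ)) * E := hcount
    _ ≤ β * (L i).card * (L j).card * E := mul_le_mul_of_nonneg_right h (Nat.cast_nonneg _)
    _ = _ := by ring

open scoped Classical in
/-- A dense family with `|α|` members contains many monochromatic cliques of order `|α|`. -/
theorem DenseFamily.le_card_hom {V α : Type*} [Fintype V] [Fintype α] {χ : V → V → Bool}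
    (hsymm : ∀ x y, χ x y = χ y x) {c : Bool} {β s : ℝ} {S : Finset V} {L : List (Finset V)}
    (hL : DenseFamily χ c β s S L) (hs : 0 ≤ s) (hlen : Fintype.card α ≤ L.length) (hβ0 : 0 ≤ β)
    (hβ : (Fintype.card α : ℝ) ^ 2 * β ≤ 1 / 2) :
    1 / 2 * s ^ Fintype.card α ≤ (((Finset.univ : Finset (α → V)).filter fun g =>
        ∀ u v, u ≠ v → χ (g u) (g v) = c).card : ℝ) := by
  set e := Fintype.equivFin α with he
  set A : α → Finset V := fun u => L.get (Fin.castLE hlen (e u)) with hA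
  have hAs : ∀ u, s ≤ (A u).card := fun u => (hL.1 _ (List.get_mem _ _)).2
  set P : ℝ := ∏ u, ((A u).card : ℝ) with hP
  have hP0 : s ^ Fintype.card α ≤ P := by
    rw [← Finset.card_univ, ← Finset.prod_const]
    exact Finset.prod_le_prod (fun _ _ => hs) fun u _ => hAs u
  have hPnn : 0 ≤ P := Finset.prod_nonneg fun _ _ => Nat.cast_nonneg _
  have hbad : ∀ p : α × α, (((Fintype.piFinset A).filter
      fun g => e p.1 < e p.2 ∧ χ (g p.1) (g p.2) = !c).card : ℝ) ≤ β * P := by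
    rintro ⟨u, v⟩
    by_cases huv : e u < e v
    · have hne : u ≠ v := by rintro rfl; exact lt_irrefl _ huv
      simp only [huv, true_and]
      convert card_piFinset_filter_le (L := A) (R := fun x y => χ x y = !c) hne ?_
      convert List.pairwise_iff_get.1 hL.2 (Fin.castLE hlen (e u)) (Fin.castLE hlen (e v)) huv
    · simp only [huv, false_and, Finset.filter_false, Finset.card_empty, Nat.cast_zero]
      exact mul_nonneg hβ0 hPnn
  have hsub : Fintype.piFinset A ⊆ ((Finset.univ : Finset (α → V)).filter fun g =>
        ∀ u v, u ≠ v → χ (g u) (g v) = c) ∪ (Finset.univ : Finset (α × α)).biUnion fun p =>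
        (Fintype.piFinset A).filter fun g => e p.1 < e p.2 ∧ χ (g p.1) (g p.2) = !c := by
    intro g hg
    simp only [Finset.mem_union, Finset.mem_filter, Finset.mem_univ, true_and,
      Finset.mem_biUnion, hg, Prod.exists]
    by_contra! h
    obtain ⟨⟨u, v, huv, hc⟩, h2⟩ := h
    have hc' : χ (g u) (g v) = !c := by revert hc; cases χ (g u) (g v) <;> cases c <;> simp
    rcases lt_or_gt_of_ne (e.injective.ne huv) with hlt | hlt
    · exact h2 u v hlt hc'
    · exact h2 v u hlt (by rw [hsymm]; exact hc')
  have h1 := (Finset.card_le_card hsub).trans ((Finset.card_union_le _ _).trans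
    (Nat.add_le_add_left Finset.card_biUnion_le _))
  rw [Fintype.card_piFinset, ← Nat.cast_le (α := ℝ), Nat.cast_add, Nat.cast_sum,
    Nat.cast_prod] at h1
  have h2 := Finset.sum_le_sum fun p (_ : p ∈ (Finset.univ : Finset (α × α))) => hbad p
  rw [Finset.sum_const, nsmul_eq_mul, Finset.card_univ, Fintype.card_prod] at h2
  push_cast at h2
  have h3 : (Fintype.card α : ℝ) * Fintype.card α * (β * P) ≤ 1 / 2 * P := by
    calc _ = (Fintype.card α : ℝ) ^ 2 * β * P := by ring
      _ ≤ _ := mul_le_mul_of_nonneg_right hβ hPnn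
  linarith

open scoped Classical in
/-- A lower bound for the number of monochromatic homomorphisms in any two-colouring. -/
theorem exists_le_card_hom {V α : Type*} [Fintype V] [Nonempty V] [Fintype α]
    {χ : V → V → Bool} (hsymm : ∀ x y, χ x y = χ y x) {δ δ₁ μ : ℝ} {d q t : ℕ}
    {H : SimpleGraph α} {T : Finset α}
    (hT : ∀ v ∉ T, (Finset.univ.filter fun u => H.Adj u v).card ≤ d)
    (hq : 2 ≤ q) (hδ0 : 0 < δ)
    (hδ : δ ≤ 1 / 4) (hδ₁ : 0 ≤ δ₁) (hμ : 0 ≤ μ) (hμ1 : μ ≤ 1)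
    (h₁ : ((T.card + 2) * q : ℝ) * ((T.card + 2) * q + 1) ^ d * δ₁ ≤ 1)
    (h₂ : 2 * (T.card * ((T.card + 2) * q : ℝ) ^ T.card * μ) <
      1 / 4 * (1 / q : ℝ) ^ (2 * (T.card + 2)) * (1 - 1 / q : ℝ) ^ ((T.card + 2) * q))
    (h₃ : (d + 1) * δ ≤ δ₁ * (1 / q : ℝ) ^ d)
    (ht : Fintype.card α ^ 2 ≤ 2 ^ t)
    (hβ : (Fintype.card α : ℝ) ^ 2 * (4 * 2 ^ t * (1 / q)) ≤ 1 / 2) :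
    ∃ c, 1 / 2 * (μ ^ T.card * δ ^ Fintype.card α) *
        ((δ / 2) ^ t * Fintype.card V) ^ Fintype.card α ≤
      (((Finset.univ : Finset (α → V)).filter fun g =>
        ∀ u v, H.Adj u v → χ (g u) (g v) = c).card : ℝ) := by
  have hN : (0 : ℝ) < Fintype.card V := by exact_mod_cast Fintype.card_pos
  have hq' : (2 : ℝ) ≤ q := by exact_mod_cast hq
  have hρ0 : (0 : ℝ) < 1 / q := by positivity
  have hcard : T.card + Tᶜ.card = Fintype.card α := Finset.card_add_card_compl T
  set s : ℝ := (δ / 2) ^ t * Fintype.card V with hs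
  have hs0 : 0 < s := by positivity
  by_cases hS : ∃ S : Finset V, s ≤ S.card ∧
      Nonsparse (fun x y : {x // x ∈ S} => χ x y) δ (1 / q)
  · obtain ⟨S, hSs, hSn⟩ := hS
    have hSpos : (0 : ℝ) < S.card := hs0.trans_le hSs
    have : Nonempty {x // x ∈ S} := by
      have : 0 < S.card := by exact_mod_cast hSpos
      obtain ⟨x, hx⟩ := Finset.card_pos.1 this
      exact ⟨⟨x, hx⟩⟩
    obtain ⟨c, hc⟩ := hSn.exists_le_card_hom (fun x y => hsymm _ _) hT hq hδ0 hδ hδ₁ hμ h₁ h₂ h₃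
    refine ⟨c, ?_⟩
    rw [Fintype.card_coe] at hc
    have hmap : ((Finset.univ : Finset (α → {x // x ∈ S})).filter fun g =>
        ∀ u v, H.Adj u v → χ (g u) (g v) = c).card ≤
        ((Finset.univ : Finset (α → V)).filter fun g =>
          ∀ u v, H.Adj u v → χ (g u) (g v) = c).card := by
      refine Finset.card_le_card_of_injOn (fun g u => (g u : V)) ?_ ?_
      · intro g hg
        simpa using hg
      · intro g _ g' _ h
        funext u
        exact Subtype.ext (congrFun h u)
    have hδp : δ ^ Fintype.card α ≤ δ ^ Tᶜ.card :=
      pow_le_pow_of_le_one hδ0.le (by linarith) (by omega)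
    calc 1 / 2 * (μ ^ T.card * δ ^ Fintype.card α) * s ^ Fintype.card α
        ≤ 1 * (μ ^ T.card * δ ^ Tᶜ.card) * (S.card : ℝ) ^ Fintype.card α := by
          gcongr
          norm_num
      _ = (μ * S.card) ^ T.card * (δ * S.card) ^ Tᶜ.card := by
          rw [← hcard, pow_add, mul_pow, mul_pow]; ring
      _ ≤ _ := hc
      _ ≤ _ := by exact_mod_cast hmap
  · push Not at hS
    have hsparse : ∀ S : Finset V, s ≤ S.card → ∃ A ⊆ S, ∃ B ⊆ S, δ * S.card ≤ A.card ∧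
        δ * S.card ≤ B.card ∧ ∃ c, ∑ a ∈ A, ((B.filter fun b => χ a b = c).card : ℝ) ≤
          1 / q * A.card * B.card := by
      intro S hSs
      have h := hS S hSs
      simp only [Nonsparse, not_forall, not_le, Fintype.card_coe] at h
      obtain ⟨A, B, hA, hB, c, hc⟩ := h
      refine ⟨A.map (Function.Embedding.subtype _), fun x hx => ?_,
        B.map (Function.Embedding.subtype _), fun x hx => ?_, by simpa using hA,
        by simpa using hB, c, ?_⟩
      · obtain ⟨y, -, rfl⟩ := Finset.mem_map.1 hx
        exact y.2
      · obtain ⟨y, -, rfl⟩ := Finset.mem_map.1 hx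
        exact y.2
      · simp only [Finset.sum_map, Finset.filter_map, Finset.card_map]
        exact hc.le
    obtain ⟨L, hL, hL'⟩ := exists_denseFamily hs0 hδ0 (by linarith) hρ0 hsparse (T := t) t le_rfl
      Finset.univ (by
        rw [hs, ← mul_assoc, ← mul_pow, div_mul_div_comm, mul_comm 2 δ, div_self (by positivity),
          one_pow, one_mul, Finset.card_univ])
    obtain ⟨c, hc⟩ : ∃ c, Fintype.card α ≤ (L c).length := by
      by_contra! h
      have h1 := h true
      have h2 := h false
      nlinarith
    refine ⟨c, ?_⟩
    have := (hL' c).2.le_card_hom (α := α) hsymm hs0.le hc (by positivity) hβ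
    have hsmall : μ ^ T.card * δ ^ Fintype.card α ≤ 1 :=
      mul_le_one₀ (pow_le_one₀ hμ hμ1) (by positivity) (pow_le_one₀ hδ0.le (by linarith))
    calc 1 / 2 * (μ ^ T.card * δ ^ Fintype.card α) * s ^ Fintype.card α
        ≤ 1 / 2 * 1 * s ^ Fintype.card α := by gcongr
      _ = 1 / 2 * s ^ Fintype.card α := by ring
      _ ≤ _ := this
      _ ≤ _ := by
        rw [Nat.cast_le]
        refine Finset.card_le_card fun g hg => ?_
        simp only [Finset.mem_filter, Finset.mem_univ, true_and] at hg ⊢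
        exact fun u v huv => hg u v huv.ne

theorem one_fourth_le_one_sub_inv_pow {q : ℕ} (hq : 2 ≤ q) :
    (1 / 4 : ℝ) ≤ (1 - 1 / (q : ℝ)) ^ q := by
  have hq' : (2 : ℝ) ≤ q := by exact_mod_cast hq
  have hinv : 1 / (q : ℝ) ≤ 1 := (div_le_one (by linarith)).2 (by linarith)
  have h := one_add_mul_self_le_rpow_one_add (s := -(1 / (q : ℝ))) (p := q / 2)
    (by linarith) (by linarith)
  have h1 : 1 + (q : ℝ) / 2 * -(1 / (q : ℝ)) = 1 / 2 := by field_simp; norm_num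
  rw [h1, ← sub_eq_add_neg] at h
  calc (1 / 4 : ℝ) = (1 / 2) ^ 2 := by norm_num
    _ ≤ ((1 - 1 / (q : ℝ)) ^ ((q : ℝ) / 2)) ^ 2 := by gcongr
    _ = (1 - 1 / (q : ℝ)) ^ q := by
      rw [← Real.rpow_natCast, ← Real.rpow_mul (by linarith), ← Real.rpow_natCast]
      congr 1
      push_cast
      ring

/-- The parameters, chosen as powers of the number of edges, satisfy the hypotheses of
`exists_le_card_hom`. -/
theorem exists_card_hom_parameters {m d k h : ℕ} (hm : 2 ≤ m) (hd : 1 ≤ d) (hdm : d ≤ m)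
    (hk : k ≤ 2 * m) (hh : h ≤ 2 * m) (hh0 : 2 ≤ h) :
    ∃ (q t : ℕ) (δ δ₁ μ : ℝ), 2 ≤ q ∧ 0 < δ ∧ δ ≤ 1 / 4 ∧ 0 ≤ δ₁ ∧ 0 ≤ μ ∧ μ ≤ 1 ∧
      ((k + 2) * q : ℝ) * ((k + 2) * q + 1) ^ d * δ₁ ≤ 1 ∧
      2 * (k * ((k + 2) * q : ℝ) ^ k * μ) <
        1 / 4 * (1 / q : ℝ) ^ (2 * (k + 2)) * (1 - 1 / q : ℝ) ^ ((k + 2) * q) ∧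
      (d + 1) * δ ≤ δ₁ * (1 / q : ℝ) ^ d ∧ h ^ 2 ≤ 2 ^ t ∧
      (h : ℝ) ^ 2 * (4 * 2 ^ t * (1 / q)) ≤ 1 / 2 ∧ 2 ^ t ≤ m ^ 5 ∧
      ((m : ℝ)⁻¹) ^ (150 * k ^ 2 + 50 * (d * h) + 51 * (d * h) * t) ≤
        μ ^ k * δ ^ h * ((δ / 2) ^ t) ^ h := by
  have hm' : (2 : ℝ) ≤ m := by exact_mod_cast hm
  have hm0 : (0 : ℝ) < m := by linarith
  have hm1 : (1 : ℝ) ≤ m := by linarith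
  have hinv0 : (0 : ℝ) < (m : ℝ)⁻¹ := by positivity
  have hinv1 : (m : ℝ)⁻¹ ≤ 1 := inv_le_one_of_one_le₀ hm1
  have hhm : h ≤ m ^ 2 := by nlinarith
  have hkm : k ≤ m ^ 2 := by nlinarith
  have hk2 : k + 2 ≤ m ^ 3 := by
    have : 4 * m ≤ m ^ 3 := by
      calc 4 * m = 2 * 2 * m := by ring
        _ ≤ m * m * m := by gcongr
        _ = m ^ 3 := by ring
    omega
  have hd2 : d + 1 ≤ m ^ 2 := by nlinarith
  have ht1 : 2 ^ Nat.clog 2 (h ^ 2) ≤ 2 * h ^ 2 := by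
    have h1 := Nat.pow_pred_clog_lt_self (b := 2) one_lt_two (x := h ^ 2) (by nlinarith)
    have h2 : 0 < Nat.clog 2 (h ^ 2) := Nat.clog_pos one_lt_two (by nlinarith)
    obtain ⟨s, hs⟩ := Nat.exists_eq_succ_of_ne_zero h2.ne'
    rw [hs] at h1 ⊢
    rw [Nat.pred_succ] at h1
    rw [pow_succ]
    omega
  have hQ : (((k + 2 : ℕ) : ℝ) * (m : ℝ) ^ 13) ≤ (m : ℝ) ^ 16 := by
    calc _ ≤ (m : ℝ) ^ 3 * (m : ℝ) ^ 13 := by gcongr; exact_mod_cast hk2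
      _ = _ := by ring
  push_cast at hQ
  have hQ0 : (0 : ℝ) ≤ (k + 2) * (m : ℝ) ^ 13 := by positivity
  have hQ1 : ((k + 2) * (m : ℝ) ^ 13 + 1) ≤ (m : ℝ) ^ 17 := by
    have h1 : (1 : ℝ) ≤ (m : ℝ) ^ 16 := one_le_pow₀ hm1
    calc _ ≤ 2 * (m : ℝ) ^ 16 := by linarith
      _ ≤ m * (m : ℝ) ^ 16 := by gcongr
      _ = _ := by ring
  refine ⟨m ^ 13, Nat.clog 2 (h ^ 2), (m : ℝ)⁻¹ ^ (50 * d), (m : ℝ)⁻¹ ^ (17 * (d + 1)),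
    (m : ℝ)⁻¹ ^ (50 * k + 100), ?_, by positivity, ?_, by positivity, by positivity,
    pow_le_one₀ hinv0.le hinv1, ?_, ?_, ?_, Nat.le_pow_clog one_lt_two _, ?_, ?_, ?_⟩
  · exact hm.trans (Nat.le_self_pow (by norm_num) m)
  · calc (m : ℝ)⁻¹ ^ (50 * d) ≤ (m : ℝ)⁻¹ ^ 2 := pow_le_pow_of_le_one hinv0.le hinv1 (by omega)
      _ ≤ (2 : ℝ)⁻¹ ^ 2 := by gcongr
      _ = 1 / 4 := by norm_num
  · push_cast
    calc _ ≤ (m : ℝ) ^ 17 * ((m : ℝ) ^ 17) ^ d * (m : ℝ)⁻¹ ^ (17 * (d + 1)) := by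
          gcongr
          linarith
      _ = 1 := by
        rw [← pow_mul, ← pow_add, inv_pow, show 17 + 17 * d = 17 * (d + 1) by ring]
        exact mul_inv_cancel₀ (by positivity)
  · have hbern : (1 / 4 : ℝ) ≤ (1 - 1 / ((m ^ 13 : ℕ) : ℝ)) ^ (m ^ 13) :=
      one_fourth_le_one_sub_inv_pow (hm.trans (Nat.le_self_pow (by norm_num) m))
    calc 2 * (k * ((k + 2) * ((m ^ 13 : ℕ) : ℝ)) ^ k * (m : ℝ)⁻¹ ^ (50 * k + 100))
        ≤ m * ((m : ℝ) ^ 2 * ((m : ℝ) ^ 16) ^ k * (m : ℝ)⁻¹ ^ (50 * k + 100)) := by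
          gcongr
          · exact_mod_cast hkm
          · push_cast; exact hQ
      _ = (m : ℝ) ^ (16 * k + 3) * ((m : ℝ)⁻¹ ^ (16 * k + 3) * (m : ℝ)⁻¹ ^ (34 * k + 97)) := by
          rw [← pow_add, ← pow_mul, show 16 * k + 3 + (34 * k + 97) = 50 * k + 100 by ring]
          ring
      _ = (m : ℝ)⁻¹ ^ (34 * k + 97) := by
          rw [← mul_assoc, ← mul_pow, mul_inv_cancel₀ hm0.ne', one_pow, one_mul]
      _ < (m : ℝ)⁻¹ ^ (28 * k + 58) := by
          refine pow_lt_pow_right_of_lt_one₀ hinv0 (inv_lt_one_of_one_lt₀ (by linarith)) (by omega)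
      _ = (m : ℝ)⁻¹ ^ 2 * ((m : ℝ)⁻¹ ^ 13) ^ (2 * (k + 2)) * ((m : ℝ)⁻¹ ^ 2) ^ (k + 2) := by
          rw [← pow_mul, ← pow_mul, ← pow_add, ← pow_add]; congr 1; ring
      _ ≤ (2 : ℝ)⁻¹ ^ 2 * ((m : ℝ)⁻¹ ^ 13) ^ (2 * (k + 2)) * ((2 : ℝ)⁻¹ ^ 2) ^ (k + 2) := by
          gcongr
      _ ≤ 1 / 4 * (1 / ((m ^ 13 : ℕ) : ℝ)) ^ (2 * (k + 2)) *
          (1 - 1 / ((m ^ 13 : ℕ) : ℝ)) ^ ((k + 2) * m ^ 13) := by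
          rw [mul_comm (k + 2) (m ^ 13), pow_mul _ (m ^ 13) (k + 2)]
          have e1 : (1 / ((m ^ 13 : ℕ) : ℝ)) = (m : ℝ)⁻¹ ^ 13 := by
            push_cast; rw [one_div, inv_pow]
          rw [e1] at hbern ⊢
          have e2 : (2 : ℝ)⁻¹ ^ 2 = 1 / 4 := by norm_num
          rw [e2]
          gcongr
  · have hd2' : (d + 1 : ℝ) ≤ (m : ℝ) ^ 2 := by exact_mod_cast hd2
    have e1 : (1 / ((m ^ 13 : ℕ) : ℝ)) = (m : ℝ)⁻¹ ^ 13 := by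
      push_cast; rw [one_div, inv_pow]
    rw [e1, ← pow_mul, ← pow_add]
    calc (d + 1 : ℝ) * (m : ℝ)⁻¹ ^ (50 * d) ≤ (m : ℝ) ^ 2 * (m : ℝ)⁻¹ ^ (50 * d) := by gcongr
      _ = (m : ℝ) ^ 2 * ((m : ℝ)⁻¹ ^ 2 * (m : ℝ)⁻¹ ^ (50 * d - 2)) := by
          rw [← pow_add, show 2 + (50 * d - 2) = 50 * d by omega]
      _ = (m : ℝ)⁻¹ ^ (50 * d - 2) := by
          rw [← mul_assoc, ← mul_pow, mul_inv_cancel₀ hm0.ne', one_pow, one_mul]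
      _ ≤ _ := pow_le_pow_of_le_one hinv0.le hinv1 (by omega)
  · have hn : 8 * h ^ 2 * 2 ^ Nat.clog 2 (h ^ 2) ≤ m ^ 13 := by
      calc _ ≤ 8 * (m ^ 2) ^ 2 * (2 * (m ^ 2) ^ 2) := by
            gcongr
            exact ht1.trans (by gcongr)
        _ = 2 * 2 * 2 * 2 * m ^ 8 := by ring
        _ ≤ m * m * m * m * m ^ 8 := by gcongr
        _ = m ^ 12 := by ring
        _ ≤ m ^ 13 := Nat.pow_le_pow_right (by omega) (by norm_num)
    have hn' : (8 * h ^ 2 * 2 ^ Nat.clog 2 (h ^ 2) : ℝ) ≤ ((m ^ 13 : ℕ) : ℝ) := by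
      exact_mod_cast hn
    have hpos : (0 : ℝ) < ((m ^ 13 : ℕ) : ℝ) := by positivity
    rw [mul_one_div, ← mul_div_assoc, div_le_iff₀ hpos]
    linarith
  · calc _ ≤ 2 * h ^ 2 := ht1
      _ ≤ m * (m ^ 2) ^ 2 := by gcongr
      _ = m ^ 5 := by ring
  · set t := Nat.clog 2 (h ^ 2)
    have hδ2 : (m : ℝ)⁻¹ ^ (51 * d) ≤ (m : ℝ)⁻¹ ^ (50 * d) / 2 := by
      calc (m : ℝ)⁻¹ ^ (51 * d) ≤ (m : ℝ)⁻¹ ^ (50 * d + 1) :=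
            pow_le_pow_of_le_one hinv0.le hinv1 (by omega)
        _ = (m : ℝ)⁻¹ ^ (50 * d) * (m : ℝ)⁻¹ := pow_succ _ _
        _ ≤ (m : ℝ)⁻¹ ^ (50 * d) * (2 : ℝ)⁻¹ := by gcongr
        _ = _ := by ring
    calc (m : ℝ)⁻¹ ^ (150 * k ^ 2 + 50 * (d * h) + 51 * (d * h) * t)
        = (m : ℝ)⁻¹ ^ (150 * k ^ 2) * ((m : ℝ)⁻¹ ^ (50 * d)) ^ h *
          (((m : ℝ)⁻¹ ^ (51 * d)) ^ t) ^ h := by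
          rw [← pow_mul, ← pow_mul, ← pow_mul, ← pow_add, ← pow_add]; congr 1; ring
      _ ≤ _ := by
        rw [← pow_mul (m : ℝ)⁻¹ (50 * k + 100) k]
        gcongr ?_ * _ * (?_ ^ _) ^ _
        refine pow_le_pow_of_le_one hinv0.le hinv1 ?_
        have : k ≤ k ^ 2 := Nat.le_self_pow (by norm_num) k
        nlinarith

theorem SimpleGraph.card_le_two_mul_ncard_edgeSet {α : Type*} [Fintype α] {H : SimpleGraph α}
    (hH : ∀ v, ∃ u, H.Adj v u) : Fintype.card α ≤ 2 * H.edgeSet.ncard := by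
  classical
  rw [← SimpleGraph.coe_edgeFinset, Set.ncard_coe_finset, ← H.sum_degrees_eq_twice_card_edges,
    ← Finset.card_univ, Finset.card_eq_sum_ones]
  refine Finset.sum_le_sum fun v _ => ?_
  exact (H.degree_pos_iff_exists_adj v).2 (hH v)

open scoped Classical in
theorem SimpleGraph.card_filter_lt_degree_mul_le {α : Type*} [Fintype α] (H : SimpleGraph α)
    (d : ℕ) : (Finset.univ.filter fun v => d < H.degree v).card * d ≤ 2 * H.edgeSet.ncard := by
  rw [← SimpleGraph.coe_edgeFinset, Set.ncard_coe_finset, ← H.sum_degrees_eq_twice_card_edges,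
    ← smul_eq_mul]
  refine (Finset.card_nsmul_le_sum _ (fun v => H.degree v) d fun v hv =>
    (Finset.mem_filter.1 hv).2.le).trans ?_
  exact Finset.sum_le_sum_of_subset (Finset.filter_subset _ _)

open scoped Classical in
theorem exists_rpow_le_card_hom {V α : Type*} [Fintype V] [Nonempty V] [Fintype α]
    {χ : V → V → Bool} (hsymm : ∀ x y, χ x y = χ y x) {H : SimpleGraph α}
    (hm : 2 ≤ H.edgeSet.ncard) (hH : ∀ v, ∃ u, H.Adj v u) :
    ∃ c, (2 : ℝ) ^ (-(1821 * (H.edgeSet.ncard : ℝ) ^ ((4 : ℝ) / 3) *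
        (Real.logb 2 (H.edgeSet.ncard : ℝ)) ^ 2)) * (Fintype.card V : ℝ) ^ Fintype.card α ≤
      (((Finset.univ : Finset (α → V)).filter fun g =>
        ∀ u v, H.Adj u v → χ (g u) (g v) = c).card : ℝ) := by
  have hh := SimpleGraph.card_le_two_mul_ncard_edgeSet hH
  have hcard2 : 2 ≤ Fintype.card α := by
    have hne : H.edgeSet.Nonempty := Set.nonempty_of_ncard_ne_zero (by omega)
    obtain ⟨e, he⟩ := hne
    induction e with
    | h u v => exact Fintype.one_lt_card_iff.2 ⟨u, v, H.ne_of_adj he⟩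
  set m := H.edgeSet.ncard with hmdef
  have hm' : (2 : ℝ) ≤ m := by exact_mod_cast hm
  set y : ℝ := (m : ℝ) ^ ((1 : ℝ) / 3) with hy
  have hy3 : y ^ 3 = m := by
    rw [hy, ← Real.rpow_natCast, ← Real.rpow_mul (by positivity)]; norm_num
  have hy4 : (m : ℝ) ^ ((4 : ℝ) / 3) = y ^ 4 := by
    rw [hy, ← Real.rpow_natCast, ← Real.rpow_mul (by positivity)]; norm_num
  have hy1 : 1 ≤ y := Real.one_le_rpow (by linarith) (by norm_num)
  set d := ⌈y⌉₊ with hd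
  have hyd : y ≤ d := Nat.le_ceil y
  have hd1 : 1 ≤ d := by exact_mod_cast hy1.trans hyd
  have hdy : (d : ℝ) ≤ 2 * y := by
    have := Nat.ceil_lt_add_one (by linarith : 0 ≤ y)
    linarith
  have hdm : d ≤ m := by
    rw [hd, Nat.ceil_le, ← hy3]
    exact le_self_pow₀ hy1 (by norm_num)
  set T : Finset α := Finset.univ.filter fun v => d < H.degree v with hT
  have hkd : T.card * d ≤ 2 * m := H.card_filter_lt_degree_mul_le d
  have hk : T.card ≤ 2 * m := (Nat.le_mul_of_pos_right _ hd1).trans hkd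
  obtain ⟨q, t, δ, δ₁, μ, hq, hδ0, hδ, hδ₁, hμ, hμ1, h₁, h₂, h₃, ht, hβ, htm, hP⟩ :=
    exists_card_hom_parameters hm hd1 hdm hk hh hcard2
  obtain ⟨c, hc⟩ := exists_le_card_hom (H := H) (T := T) hsymm (fun v hv => by
    have h1 : H.degree v ≤ d := by simpa [hT] using hv
    rw [← H.card_neighborFinset_eq_degree, H.neighborFinset_eq_filter] at h1
    simpa only [H.adj_comm] using h1) hq hδ0 hδ hδ₁ hμ hμ1 h₁ h₂ h₃ ht hβ
  refine ⟨c, le_trans ?_ hc⟩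
  rw [mul_pow _ (Fintype.card V : ℝ), ← mul_assoc]
  refine mul_le_mul_of_nonneg_right ?_ (by positivity)
  rw [mul_assoc (1 / 2 : ℝ)]
  refine le_trans ?_ (mul_le_mul_of_nonneg_left hP (by norm_num))
  set L := Real.logb 2 (m : ℝ) with hL
  have hL1 : 1 ≤ L := by
    rw [hL, Real.le_logb_iff_rpow_le (by norm_num) (by linarith)]; simpa using hm'
  have htL : (t : ℝ) ≤ 5 * L := by
    have h1 : (2 : ℝ) ^ (t : ℝ) ≤ (m : ℝ) ^ 5 := by rw [Real.rpow_natCast]; exact_mod_cast htm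
    rw [← Real.le_logb_iff_rpow_le (by norm_num) (by positivity), Real.logb_pow] at h1
    exact_mod_cast h1
  have hmL : (m : ℝ)⁻¹ = (2 : ℝ) ^ (-L) := by
    rw [Real.rpow_neg (by norm_num), hL, Real.rpow_logb (by norm_num) (by norm_num) (by linarith)]
  have hky : (T.card : ℝ) ≤ 2 * y ^ 2 := by
    have h1 : (T.card : ℝ) * d ≤ 2 * m := by exact_mod_cast hkd
    have h2 : (T.card : ℝ) * y ≤ T.card * d := by gcongr
    rw [← hy3] at h1
    refine le_of_mul_le_mul_right ?_ (by linarith : 0 < y)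
    linarith
  have hk2 : (T.card : ℝ) ^ 2 ≤ 4 * y ^ 4 := by
    calc (T.card : ℝ) ^ 2 ≤ (2 * y ^ 2) ^ 2 := by gcongr
      _ = _ := by ring
  have hdh : (d : ℝ) * Fintype.card α ≤ 4 * y ^ 4 := by
    have h1 : (Fintype.card α : ℝ) ≤ 2 * m := by exact_mod_cast hh
    calc (d : ℝ) * Fintype.card α ≤ 2 * y * (2 * m) := by gcongr
      _ = _ := by rw [← hy3]; ring
  have hy4' : 1 ≤ y ^ 4 := one_le_pow₀ hy1
  rw [hmL, ← Real.rpow_natCast (2 ^ (-L)), ← Real.rpow_mul (by norm_num),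
    show (1 / 2 : ℝ) = 2 ^ (-1 : ℝ) by rw [Real.rpow_neg_one]; norm_num,
    ← Real.rpow_add (by norm_num), hy4]
  refine Real.rpow_le_rpow_of_exponent_le (by norm_num) ?_
  push_cast
  have h1 : (d : ℝ) * Fintype.card α * t ≤ 4 * y ^ 4 * (5 * L) := by gcongr
  have h2 : y ^ 4 ≤ y ^ 4 * L := le_mul_of_one_le_right (by positivity) hL1
  have h3 : 150 * (T.card : ℝ) ^ 2 + 50 * (d * Fintype.card α) +
      51 * (d * Fintype.card α) * t ≤ 1820 * (y ^ 4 * L) := by linarith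
  have h4 : 1 ≤ y ^ 4 * L ^ 2 := one_le_mul_of_one_le_of_one_le hy4' (one_le_pow₀ hL1)
  have h5 := mul_le_mul_of_nonneg_left h3 (by linarith : 0 ≤ L)
  linarith

open scoped Classical in
/-- The number of non-injective maps into an `n`-element set is at most `|α|² n^(|α| - 1)`. -/
theorem card_filter_not_injective_mul_le {α V : Type*} [Fintype α] [Fintype V] :
    ((Finset.univ : Finset (α → V)).filter fun g => ¬ Function.Injective g).card *
      Fintype.card V ≤ Fintype.card α ^ 2 * Fintype.card V ^ Fintype.card α := by
  have hpair : ∀ p : α × α, ((Finset.univ : Finset (α → V)).filter fun g =>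
      p.1 ≠ p.2 ∧ g p.1 = g p.2).card * Fintype.card V ≤ Fintype.card V ^ Fintype.card α := by
    rintro ⟨u, v⟩
    rw [← Fintype.card_fun, ← Finset.card_univ, ← Finset.card_univ, ← Finset.card_product]
    refine Finset.card_le_card_of_injOn (fun x => Function.update x.1 u x.2)
      (fun _ _ => Finset.mem_coe.2 (Finset.mem_univ _)) ?_
    rintro ⟨g, x⟩ hg ⟨g', x'⟩ hg' h
    simp only [Finset.coe_product, Finset.coe_filter, Finset.mem_univ, true_and,
      Set.mem_prod, Set.mem_ofPred_eq] at hg hg'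
    have hne : ∀ w, w ≠ u → g w = g' w := fun w hw => by
      simpa [hw] using congrFun h w
    have hx : x = x' := by simpa using congrFun h u
    refine Prod.ext (funext fun w => ?_) hx
    by_cases hw : w = u
    · subst hw
      change g w = g' w
      rw [hg.1.2, hg'.1.2]
      exact hne v hg.1.1.symm
    · exact hne w hw
  have hsub : ((Finset.univ : Finset (α → V)).filter fun g => ¬ Function.Injective g) ⊆
      (Finset.univ : Finset (α × α)).biUnion fun p =>
        (Finset.univ : Finset (α → V)).filter fun g => p.1 ≠ p.2 ∧ g p.1 = g p.2 := by
    intro g hg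
    simp only [Finset.mem_filter, Finset.mem_univ, true_and, Function.not_injective_iff] at hg
    obtain ⟨u, v, h1, h2⟩ := hg
    simp only [Finset.mem_biUnion, Finset.mem_filter, Finset.mem_univ, true_and]
    exact ⟨(u, v), h2, h1⟩
  calc _ ≤ (∑ p : α × α, ((Finset.univ : Finset (α → V)).filter fun g =>
        p.1 ≠ p.2 ∧ g p.1 = g p.2).card) * Fintype.card V :=
        Nat.mul_le_mul_right _ ((Finset.card_le_card hsub).trans Finset.card_biUnion_le)
    _ ≤ ∑ _p : α × α, Fintype.card V ^ Fintype.card α := by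
        rw [Finset.sum_mul]
        exact Finset.sum_le_sum fun p _ => hpair p
    _ = _ := by
        rw [Finset.sum_const, Finset.card_univ, Fintype.card_prod, smul_eq_mul, sq]

open scoped Classical in
/-- Injective maps into `V` with the property `p` have at least `#{injective maps} / |α|!`
images. -/
theorem card_filter_injective_le {α V : Type*} [Fintype α] [Fintype V] (p : (α → V) → Prop) :
    ((Finset.univ : Finset (α → V)).filter fun g => Function.Injective g ∧ p g).card ≤
      {S : Finset V | S.card = Fintype.card α ∧ ∃ f : α ↪ V, (∀ w, f w ∈ S) ∧ p f}.ncard *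
        (Fintype.card α).factorial := by
  rw [Set.ncard_eq_toFinset_card', mul_comm]
  refine Finset.card_le_mul_card_image_of_maps_to (f := fun g => Finset.univ.image g) ?_ _ ?_
  · intro g hg
    obtain ⟨hi, hp⟩ := (Finset.mem_filter.1 hg).2
    rw [Set.mem_toFinset]
    exact ⟨Finset.card_image_of_injective _ hi, ⟨g, hi⟩,
      fun w => Finset.mem_image_of_mem _ (Finset.mem_univ w), hp⟩
  · intro S hS
    rw [Set.mem_toFinset] at hS
    have hcard : Fintype.card (α ↪ {x // x ∈ S}) = (Fintype.card α).factorial := by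
      rw [Fintype.card_embedding_eq, Fintype.card_coe, hS.1, Nat.descFactorial_self]
    rw [← hcard, ← Fintype.card_coe]
    have key : ∀ g : {g // g ∈ ((Finset.univ : Finset (α → V)).filter fun g =>
        Function.Injective g ∧ p g).filter fun g => Finset.univ.image g = S},
        Function.Injective g.1 ∧ ∀ w, g.1 w ∈ S := by
      rintro ⟨g, hg⟩
      simp only [Finset.mem_filter, Finset.mem_univ, true_and] at hg
      refine ⟨hg.1.1, fun w => ?_⟩
      have := Finset.mem_image_of_mem g (Finset.mem_univ w)
      rwa [hg.2] at this
    refine Fintype.card_le_of_injective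
      (fun g => ⟨fun w => ⟨g.1 w, (key g).2 w⟩, fun a b h => (key g).1 (by simpa using h)⟩) ?_
    intro g g' h
    refine Subtype.ext (funext fun w => ?_)
    exact congrArg (fun f : α ↪ {x // x ∈ S} => (f w : V)) h

open scoped Classical in
/-- All but at most `|α|² n^(|α| - 1)` of the maps with the property `p` are injective. -/
theorem card_filter_mul_card_le {α V : Type*} [Fintype α] [Fintype V] (p : (α → V) → Prop) :
    (Finset.univ.filter p).card * Fintype.card V ≤
      {S : Finset V | S.card = Fintype.card α ∧ ∃ f : α ↪ V, (∀ w, f w ∈ S) ∧ p f}.ncard *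
        (Fintype.card α).factorial * Fintype.card V +
      Fintype.card α ^ 2 * Fintype.card V ^ Fintype.card α := by
  have hsub : Finset.univ.filter p ⊆ (Finset.univ.filter fun g => Function.Injective g ∧ p g) ∪
      (Finset.univ.filter fun g : α → V => ¬ Function.Injective g) := by
    intro g hg
    by_cases hi : Function.Injective g
    · exact Finset.mem_union_left _
        (Finset.mem_filter.2 ⟨Finset.mem_univ _, hi, (Finset.mem_filter.1 hg).2⟩)
    · exact Finset.mem_union_right _ (Finset.mem_filter.2 ⟨Finset.mem_univ _, hi⟩)
  refine (Nat.mul_le_mul_right _ ((Finset.card_le_card hsub).trans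
    (Finset.card_union_le _ _))).trans ?_
  rw [add_mul]
  exact Nat.add_le_add (Nat.mul_le_mul_right _ (card_filter_injective_le p))
    card_filter_not_injective_mul_le

/-- There is `c > 0` such that for every graph `H` with `m ≥ 2` edges and no isolated
vertices (with `h` vertices), for all sufficiently large `n`, every red/blue coloring of the
edges of `K_n` contains at least `2^{-c m^{4/3} (log m)²} C(n,h)` monochromatic copies of
`H`, i.e. `h`-subsets carrying a copy of `H` with all edges of one color (logs base 2).
In particular `C₂(H) ≥ 2^{-c m^{4/3} (log m)²}`. -/
theorem two_color_ramsey_multiplicity :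
    ∃ c : ℝ, 0 < c ∧
      ∀ (α : Type) [Fintype α] (H : SimpleGraph α),
        2 ≤ H.edgeSet.ncard →
        (∀ v : α, ∃ u : α, H.Adj u v) →
        ∃ n₀ : ℕ, ∀ n : ℕ, n₀ ≤ n →
          ∀ χ : Sym2 (Fin n) → Bool,
            (2 : ℝ) ^ (-(c * (H.edgeSet.ncard : ℝ) ^ ((4 : ℝ) / 3) *
                (Real.logb 2 (H.edgeSet.ncard : ℝ)) ^ 2)) *
                (n.choose (Fintype.card α) : ℝ) ≤
              ({S : Finset (Fin n) | S.card = Fintype.card α ∧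
                  ∃ (b : Bool) (f : α ↪ Fin n), (∀ w : α, f w ∈ S) ∧
                    ∀ u v : α, H.Adj u v → χ s(f u, f v) = b}.ncard : ℝ) := by
  classical
  refine ⟨1822, by norm_num, fun α _ H hm hH => ?_⟩
  set X : ℝ := (H.edgeSet.ncard : ℝ) ^ ((4 : ℝ) / 3) *
    (Real.logb 2 (H.edgeSet.ncard : ℝ)) ^ 2 with hX
  have hX1 : 1 ≤ X := by
    have hm' : (2 : ℝ) ≤ H.edgeSet.ncard := by exact_mod_cast hm
    refine one_le_mul_of_one_le_of_one_le (Real.one_le_rpow (by linarith) (by norm_num))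
      (one_le_pow₀ ?_)
    rw [Real.le_logb_iff_rpow_le (by norm_num) (by linarith)]
    simpa using hm'
  set P : ℝ := (2 : ℝ) ^ (-(1821 * X)) with hP
  have hP0 : 0 < P := by positivity
  have hP2 : (2 : ℝ) ^ (-(1822 * X)) ≤ P / 2 := by
    calc (2 : ℝ) ^ (-(1822 * X)) ≤ (2 : ℝ) ^ (-(1821 * X) - 1) :=
          Real.rpow_le_rpow_of_exponent_le (by norm_num) (by linarith)
      _ = P / 2 := by rw [Real.rpow_sub (by norm_num), Real.rpow_one]
  set h := Fintype.card α with hh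
  refine ⟨⌈2 * (h : ℝ) ^ 2 / P⌉₊ + 1, fun n hn χ => ?_⟩
  have hn0 : 0 < n := by omega
  have hn0' : (0 : ℝ) < n := by exact_mod_cast hn0
  have hnP : 2 * (h : ℝ) ^ 2 ≤ P * n := by
    have h1 : 2 * (h : ℝ) ^ 2 / P ≤ n :=
      (Nat.le_ceil _).trans (by exact_mod_cast (Nat.le_succ _).trans hn)
    rw [div_le_iff₀ hP0] at h1
    linarith
  have : Nonempty (Fin n) := ⟨⟨0, hn0⟩⟩
  obtain ⟨c, hc⟩ := exists_rpow_le_card_hom (V := Fin n) (χ := fun x y => χ s(x, y))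
    (fun x y => by rw [Sym2.eq_swap]) hm (fun v => (hH v).imp fun u hu => hu.symm)
  rw [Fintype.card_fin, mul_assoc 1821, ← hX, ← hP, ← hh] at hc
  rw [mul_assoc 1822, ← hX]
  set p : (α → Fin n) → Prop := fun g => ∀ u v, H.Adj u v → χ s(g u, g v) = c with hp
  have hle := card_filter_mul_card_le fun g : α → Fin n => ∀ u v, H.Adj u v → χ s(g u, g v) = c
  rw [Fintype.card_fin, ← hh, ← Nat.cast_le (α := ℝ)] at hle
  push_cast at hle
  set K : ℕ := {S : Finset (Fin n) | S.card = h ∧ ∃ f : α ↪ Fin n, (∀ w, f w ∈ S) ∧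
    ∀ u v, H.Adj u v → χ s(f u, f v) = c}.ncard with hK
  have hcopies : P / 2 * (n : ℝ) ^ h ≤ K * (h.factorial : ℝ) := by
    refine le_of_mul_le_mul_right ?_ hn0'
    have h1 : P * (n : ℝ) ^ h * n ≤ K * (h.factorial : ℝ) * n + (h : ℝ) ^ 2 * (n : ℝ) ^ h := by
      refine (mul_le_mul_of_nonneg_right hc hn0'.le).trans (le_trans (le_of_eq ?_) hle)
      congr!
    have h2 : 2 * (h : ℝ) ^ 2 * (n : ℝ) ^ h ≤ P * n * (n : ℝ) ^ h := by gcongr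
    linarith
  have hchoose : ((n.choose h : ℕ) : ℝ) * (h.factorial : ℝ) ≤ (n : ℝ) ^ h := by
    have := Nat.descFactorial_le_pow n h
    rw [Nat.descFactorial_eq_factorial_mul_choose, mul_comm] at this
    exact_mod_cast this
  have hfac : (0 : ℝ) < (h.factorial : ℝ) := by exact_mod_cast h.factorial_pos
  refine le_of_mul_le_mul_right ?_ hfac
  calc (2 : ℝ) ^ (-(1822 * X)) * (n.choose h : ℝ) * (h.factorial : ℝ)
      ≤ P / 2 * ((n.choose h : ℝ) * (h.factorial : ℝ)) := by
        rw [mul_assoc]; gcongr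
    _ ≤ P / 2 * (n : ℝ) ^ h := by gcongr
    _ ≤ _ := hcopies
    _ ≤ _ := by
      gcongr
      rw [hK]
      exact Set.ncard_le_ncard (fun S ⟨hS, f, hf⟩ => ⟨hS, c, f, hf⟩) (Set.toFinite _)
end

section
/- For every sufficiently large integer m the following holds for all sufficiently large n. Suppose the edges of the complete graph K_n are colored red and blue. Then there are at least 2^{−50·m^{4/3}·log m} · C(n, ⌈m^{2/3}⌉) monochromatic cliques K of order ⌈m^{2/3}⌉ such that, for each such clique K, every subset L of the vertex set of K of size ⌈2·m^{1/3}⌉ has at least 2^{−50·m^{1/3}·log m} · n vertices of K_n joined to every element of L in the same color as the clique K. Logarithms are base 2. -/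
open Finset

section
variable {V : Type*} [DecidableEq V]

/-- Supersaturation: if every `R`-subset of `A` contains a member of `G`, unless it contains one of
the few exceptional `j`-sets of `B`, then `G` has positive density among the `k`-subsets of `A`. -/
theorem choose_le_two_mul_choose_mul_card {A : Finset V} {R j k : ℕ} {B G : Finset (Finset V)}
    (hjR : j ≤ R) (hkR : k ≤ R) (hRA : R ≤ #A)
    (hB : B ⊆ powersetCard j A) (hG : G ⊆ powersetCard k A)
    (hBcard : 2 * #B * R.choose j ≤ (#A).choose j)
    (h : ∀ S ∈ powersetCard R A, (∃ L ∈ B, L ⊆ S) ∨ ∃ K ∈ G, K ⊆ S) :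
    (#A).choose k ≤ 2 * R.choose k * #G := by
  have hcover : (#A).choose R ≤
      #B * (#A - j).choose (R - j) + #G * (#A - k).choose (R - k) := by
    rw [← card_powersetCard]
    have hsub : powersetCard R A ⊆
        (B.biUnion fun L => {S ∈ powersetCard R A | L ⊆ S}) ∪
          G.biUnion fun K => {S ∈ powersetCard R A | K ⊆ S} := by
      intro S hS
      simp only [mem_union, mem_biUnion, mem_filter]
      rcases h S hS with ⟨L, hL, hLS⟩ | ⟨K, hK, hKS⟩
      · exact .inl ⟨L, hL, hS, hLS⟩
      · exact .inr ⟨K, hK, hS, hKS⟩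
    refine (card_le_card hsub).trans ((card_union_le _ _).trans (add_le_add ?_ ?_))
    · refine card_biUnion_le_card_mul _ _ _ fun L hL => ?_
      obtain ⟨hLA, hLj⟩ := mem_powersetCard.mp (hB hL)
      rw [card_filter_powersetCard_subset _ _ _ ‹_› (by omega), hLj]
    · refine card_biUnion_le_card_mul _ _ _ fun K hK => ?_
      obtain ⟨hKA, hKk⟩ := mem_powersetCard.mp (hG hK)
      rw [card_filter_powersetCard_subset _ _ _ ‹_› (by omega), hKk]
  have hj := Nat.choose_mul (n := #A) hjR
  have hk := Nat.choose_mul (n := #A) hkR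
  have hBhalf : 2 * #B * (#A - j).choose (R - j) ≤ (#A).choose R := by
    refine Nat.le_of_mul_le_mul_right ?_ (Nat.choose_pos hjR)
    calc _ = 2 * #B * R.choose j * (#A - j).choose (R - j) := by ring
      _ ≤ _ := by rw [hj]; gcongr
  have hGhalf : (#A).choose R ≤ 2 * #G * (#A - k).choose (R - k) := by linarith
  refine Nat.le_of_mul_le_mul_right ?_ (Nat.choose_pos (Nat.sub_le_sub_right hRA k) :
    0 < (#A - k).choose (R - k))
  rw [← hk]
  calc _ ≤ 2 * #G * (#A - k).choose (R - k) * R.choose k := by gcongr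
    _ = _ := by ring

/-- All edges inside `K` have color `b`. -/
def IsMono (χ : Sym2 V → Bool) (b : Bool) (K : Finset V) : Prop :=
  ∀ u ∈ K, ∀ v ∈ K, u ≠ v → χ s(u, v) = b

theorem IsMono.insert {χ : Sym2 V → Bool} {b : Bool} {K : Finset V} {v : V}
    (hK : IsMono χ b K) (hv : ∀ u ∈ K, χ s(v, u) = b) : IsMono χ b (insert v K) := by
  intro x hx y hy hxy
  rw [mem_insert] at hx hy
  rcases hx with rfl | hx <;> rcases hy with rfl | hy
  · exact absurd rfl hxy
  · exact hv y hy
  · rw [Sym2.eq_swap]; exact hv x hx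
  · exact hK x hx y hy hxy

/-- The Erdős–Szekeres bound for two-color Ramsey numbers, in a weak form. -/
theorem exists_isMono_of_two_pow_le_card (χ : Sym2 V → Bool) (r b : ℕ) (S : Finset V)
    (hS : 2 ^ (r + b) ≤ #S) :
    (∃ K ⊆ S, #K = r ∧ IsMono χ true K) ∨ ∃ K ⊆ S, #K = b ∧ IsMono χ false K := by
  induction r generalizing b S with
  | zero => exact .inl ⟨∅, by simp, by simp, by simp [IsMono]⟩
  | succ r ihr =>
    induction b generalizing S with
    | zero => exact .inr ⟨∅, by simp, by simp, by simp [IsMono]⟩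
    | succ b ihb =>
      obtain ⟨v, hv⟩ : S.Nonempty := card_pos.mp ((Nat.two_pow_pos _).trans_le hS)
      have hsplit := card_filter_add_card_filter_not (s := S.erase v) (fun u => χ s(v, u) = true)
      rw [card_erase_of_mem hv] at hsplit
      have hpow : 2 ^ (r + 1 + (b + 1)) = 2 ^ (r + (b + 1)) + 2 ^ (r + 1 + b) := by ring
      have hpow' : 2 ^ (r + (b + 1)) = 2 ^ (r + 1 + b) := by ring
      by_cases hred : 2 ^ (r + (b + 1)) ≤ #{u ∈ S.erase v | χ s(v, u) = true}
      · rcases ihr (b + 1) _ hred with ⟨K, hKS, hK, hm⟩ | ⟨K, hKS, hK, hm⟩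
        · have hvK : v ∉ K := fun hvK => by simpa using hKS hvK
          refine .inl ⟨insert v K, insert_subset hv ?_, by rw [card_insert_of_notMem hvK, hK],
            hm.insert fun u hu => (mem_filter.mp (hKS hu)).2⟩
          exact hKS.trans ((filter_subset _ _).trans (erase_subset _ _))
        · exact .inr ⟨K, hKS.trans ((filter_subset _ _).trans (erase_subset _ _)), hK, hm⟩
      · have hblue : 2 ^ (r + 1 + b) ≤ #{u ∈ S.erase v | ¬ χ s(v, u) = true} := by omega
        rcases ihb _ hblue with ⟨K, hKS, hK, hm⟩ | ⟨K, hKS, hK, hm⟩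
        · exact .inl ⟨K, hKS.trans ((filter_subset _ _).trans (erase_subset _ _)), hK, hm⟩
        · have hvK : v ∉ K := fun hvK => by simpa using hKS hvK
          refine .inr ⟨insert v K, insert_subset hv ?_, by rw [card_insert_of_notMem hvK, hK],
            hm.insert fun u hu => by simpa using (mem_filter.mp (hKS hu)).2⟩
          exact hKS.trans ((filter_subset _ _).trans (erase_subset _ _))

end

/-- First moment: a large average of `f` and a small average of `g` are attained jointly. -/
theorem exists_le_and_le_of_sum {ι : Type*} {P : Finset ι} (hP : P.Nonempty) {f g : ι → ℝ}
    {F G n : ℝ} (hF : 0 < F) (hG : 0 < G) (hg : ∀ p ∈ P, 0 ≤ g p) (hfn : ∀ p ∈ P, f p ≤ n)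
    (hf : 2 * F * #P ≤ ∑ p ∈ P, f p) (hgs : ∑ p ∈ P, g p ≤ G * #P) :
    ∃ p ∈ P, F ≤ f p ∧ g p ≤ G * n / F := by
  by_contra! hcon
  have hlt : ∀ p ∈ P, f p < F + F / G * g p := by
    intro p hp
    have := hg p hp
    by_cases h : F ≤ f p
    · have h2 := hcon p hp h
      have : n < F / G * g p := by
        calc n = F / G * (G * n / F) := by field_simp
          _ < _ := by gcongr
      linarith [hfn p hp]
    · have : 0 ≤ F / G * g p := by positivity
      linarith
  have hsum := sum_lt_sum_of_nonempty hP hlt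
  rw [sum_add_distrib, sum_const, nsmul_eq_mul, ← mul_sum] at hsum
  have : F / G * ∑ p ∈ P, g p ≤ F / G * (G * #P) := by gcongr
  have h2 : F / G * (G * #P) = F * #P := by field_simp
  linarith

theorem pow_mul_choose_le_pow_mul_choose {a n k : ℕ} (hk : 2 * k ≤ a) :
    a ^ k * n.choose k ≤ (2 * n) ^ k * a.choose k := by
  refine Nat.le_of_mul_le_mul_right ?_ k.factorial_pos
  have h1 := Nat.descFactorial_eq_factorial_mul_choose n k
  have h2 := Nat.descFactorial_eq_factorial_mul_choose a k
  have h3 := Nat.descFactorial_le_pow n k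
  have h4 := Nat.pow_sub_le_descFactorial a k
  calc _ = a ^ k * n.descFactorial k := by rw [h1]; ring
    _ ≤ (2 * (a + 1 - k)) ^ k * n ^ k := by gcongr; omega
    _ = (2 * n) ^ k * (a + 1 - k) ^ k := by simp only [mul_pow]; ring
    _ ≤ (2 * n) ^ k * a.descFactorial k := by gcongr
    _ = _ := by rw [h2]; ring

section
variable {V : Type*} [DecidableEq V] [Fintype V]

/-- The vertices joined to every element of `L` in color `b`. -/
def colorNbrs (χ : Sym2 V → Bool) (b : Bool) (L : Finset V) : Finset V :=
  {w | w ∉ L ∧ ∀ u ∈ L, χ s(w, u) = b}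

/-- Families of `k` vertices for each color `b` that are all joined to `L` in color `b`. -/
def nbrFamilies (χ : Sym2 V → Bool) (k : ℕ) (L : Finset V) : Finset (Bool → Fin k → V) :=
  Fintype.piFinset fun b => Fintype.piFinset fun _ => colorNbrs χ b L

theorem mem_nbrFamilies {χ : Sym2 V → Bool} {k : ℕ} {L : Finset V} {p : Bool → Fin k → V} :
    p ∈ nbrFamilies χ k L ↔ ∀ b i, p b i ∈ colorNbrs χ b L := by
  simp [nbrFamilies]

theorem card_nbrFamilies (χ : Sym2 V → Bool) (k : ℕ) (L : Finset V) :
    #(nbrFamilies χ k L) = #(colorNbrs χ true L) ^ k * #(colorNbrs χ false L) ^ k := by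
  simp [nbrFamilies]

/-- The `ℓ`-subsets of `A` with fewer than `D` common neighbors in some color. -/
noncomputable def poorSets (χ : Sym2 V → Bool) (ℓ : ℕ) (D : ℝ) (A : Finset V) :
    Finset (Finset V) :=
  {L ∈ powersetCard ℓ A | ∃ b, (#(colorNbrs χ b L) : ℝ) < D}

/-- Dependent random choice in both colors simultaneously. -/
theorem exists_large_of_few_poorSets (χ : Sym2 V → Bool) {W : Finset V} (k ℓ : ℕ) {q δ : ℝ}
    (hq : 0 < q) (hδ : 0 < δ) (hV : 0 < Fintype.card V)
    (hW : (Fintype.card V : ℝ) / 2 ≤ #W)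
    (hdeg : ∀ u ∈ W, ∀ b, q * Fintype.card V ≤ #(colorNbrs χ b {u})) :
    ∃ A : Finset V, q ^ (2 * k) * Fintype.card V / 4 ≤ #A ∧
      (#(poorSets χ ℓ (δ * Fintype.card V) A) : ℝ) ≤
        4 * Fintype.card V ^ ℓ * δ ^ k / q ^ (2 * k) := by
  classical
  set n := Fintype.card V with hn
  have hn0 : (0 : ℝ) < n := by exact_mod_cast hV
  have : Nonempty V := Fintype.card_pos_iff.mp hV
  let A : (Bool → Fin k → V) → Finset V := fun p => {u ∈ W | p ∈ nbrFamilies χ k {u}}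
  have hP : (#(univ : Finset (Bool → Fin k → V)) : ℝ) = n ^ (2 * k) := by
    simp [hn, ← pow_mul, mul_comm]
  have hf : 2 * (q ^ (2 * k) * n / 4) * #(univ : Finset (Bool → Fin k → V)) ≤
      ∑ p, (#(A p) : ℝ) := by
    have hdc : ∑ p, (#(A p) : ℝ) = ∑ u ∈ W, (#(nbrFamilies χ k {u}) : ℝ) := by
      have := sum_card_bipartiteAbove_eq_sum_card_bipartiteBelow (s := univ) (t := W)
        (fun (p : Bool → Fin k → V) u => p ∈ nbrFamilies χ k {u})
      simp only [bipartiteAbove, bipartiteBelow, filter_univ_mem] at this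
      exact_mod_cast this
    rw [hdc, hP]
    have hle : ∀ u ∈ W, (q * n) ^ (2 * k) ≤ (#(nbrFamilies χ k {u}) : ℝ) := by
      intro u hu
      rw [card_nbrFamilies]
      push_cast
      calc (q * n) ^ (2 * k) = (q * n) ^ k * (q * n) ^ k := by ring
        _ ≤ _ := by gcongr <;> exact hdeg u hu _
    calc 2 * (q ^ (2 * k) * n / 4) * (n : ℝ) ^ (2 * k) = n / 2 * (q * n) ^ (2 * k) := by ring
      _ ≤ #W * (q * n) ^ (2 * k) := by gcongr
      _ ≤ _ := by simpa using card_nsmul_le_sum W _ _ hle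
  have hg : ∑ p, (#(poorSets χ ℓ (δ * n) (A p)) : ℝ) ≤
      n ^ ℓ * δ ^ k * #(univ : Finset (Bool → Fin k → V)) := by
    have hdc : ∑ p, #(poorSets χ ℓ (δ * n) (A p)) ≤
        ∑ L ∈ poorSets χ ℓ (δ * n) univ, #(nbrFamilies χ k L) := by
      have := sum_card_bipartiteAbove_eq_sum_card_bipartiteBelow (s := univ)
        (t := poorSets χ ℓ (δ * n) univ) (fun (p : Bool → Fin k → V) L => p ∈ nbrFamilies χ k L)
      simp only [bipartiteAbove, bipartiteBelow, filter_univ_mem] at this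
      rw [← this]
      refine sum_le_sum fun p _ => card_le_card fun L hL => ?_
      simp only [poorSets, mem_filter, mem_powersetCard, subset_univ, true_and] at hL ⊢
      refine ⟨⟨hL.1.2, hL.2⟩, mem_nbrFamilies.mpr fun b i => ?_⟩
      have hmem : ∀ u ∈ L, p b i ∈ colorNbrs χ b {u} := fun u hu =>
        mem_nbrFamilies.mp (mem_filter.mp (hL.1.1 hu)).2 b i
      simp only [colorNbrs, mem_filter, mem_univ, true_and, mem_singleton, forall_eq] at hmem ⊢
      exact ⟨fun h => (hmem _ h).1 rfl, fun u hu => (hmem u hu).2⟩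
    have hle : ∀ L ∈ poorSets χ ℓ (δ * n) univ,
        (#(nbrFamilies χ k L) : ℝ) ≤ δ ^ k * n ^ (2 * k) := by
      intro L hL
      obtain ⟨b, hb⟩ := (mem_filter.mp hL).2
      rw [card_nbrFamilies]
      push_cast
      have heq : δ ^ k * (n : ℝ) ^ (2 * k) = (δ * n) ^ k * n ^ k := by ring
      rw [heq]
      cases b
      · rw [mul_comm]
        gcongr
        exact card_le_univ _
      · gcongr
        exact card_le_univ _
    have hcard : (#(poorSets χ ℓ (δ * n) univ) : ℝ) ≤ n ^ ℓ := by
      have : #(poorSets χ ℓ (δ * n) (univ : Finset V)) ≤ n ^ ℓ := by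
        refine (card_filter_le _ _).trans ?_
        rw [card_powersetCard, card_univ]
        exact Nat.choose_le_pow _ _
      exact_mod_cast this
    calc ∑ p, (#(poorSets χ ℓ (δ * n) (A p)) : ℝ)
        ≤ ∑ L ∈ poorSets χ ℓ (δ * n) univ, (#(nbrFamilies χ k L) : ℝ) := by exact_mod_cast hdc
      _ ≤ #(poorSets χ ℓ (δ * n) univ) * (δ ^ k * n ^ (2 * k)) := by
          simpa using sum_le_card_nsmul _ _ _ hle
      _ ≤ n ^ ℓ * (δ ^ k * n ^ (2 * k)) := by gcongr
      _ = _ := by rw [hP]; ring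
  obtain ⟨p, -, hpA, hpoor⟩ := exists_le_and_le_of_sum univ_nonempty (by positivity)
    (by positivity) (fun _ _ => Nat.cast_nonneg _)
    (fun p _ => (by exact_mod_cast card_le_univ (A p) : (#(A p) : ℝ) ≤ n)) hf hg
  refine ⟨A p, hpA, hpoor.trans_eq ?_⟩
  field_simp

/-- The monochromatic cliques of order `k` all of whose `ℓ`-subsets have at least `D` common
neighbors in the color of the clique. -/
noncomputable def richCliques (χ : Sym2 V → Bool) (k ℓ : ℕ) (D : ℝ) : Finset (Finset V) :=
  open Classical in
  {K ∈ powersetCard k univ | ∃ b, IsMono χ b K ∧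
    ∀ L ⊆ K, #L = ℓ → D ≤ #(colorNbrs χ b L)}

theorem choose_le_mul_card_richCliques_of_few_poorSets (χ : Sym2 V → Bool) {k ℓ : ℕ} {D : ℝ}
    {A : Finset V} (hℓ : ℓ ≤ k) (hA : 4 ^ k ≤ #A)
    (hpoor : 2 * #(poorSets χ ℓ D A) * (4 ^ k).choose ℓ ≤ (#A).choose ℓ) :
    (#A).choose k ≤ 2 * (4 ^ k).choose k * #(richCliques χ k ℓ D) := by
  classical
  have hk : k ≤ 4 ^ k := (Nat.lt_pow_self (by norm_num)).le
  refine (choose_le_two_mul_choose_mul_card (hℓ.trans hk) hk hA (filter_subset _ _)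
    (G := {K ∈ richCliques χ k ℓ D | K ⊆ A}) ?_ hpoor ?_).trans
    (Nat.mul_le_mul_left _ (card_le_card (filter_subset _ _)))
  · intro K hK
    simp only [richCliques, mem_filter, mem_powersetCard] at hK ⊢
    exact ⟨hK.2, hK.1.1.2⟩
  · intro S hS
    rw [mem_powersetCard] at hS
    refine or_iff_not_imp_left.mpr fun hno => ?_
    have hrich : ∀ b, ∀ L ⊆ S, #L = ℓ → D ≤ #(colorNbrs χ b L) := by
      intro b L hLS hL
      by_contra! hlt
      exact hno ⟨L, mem_filter.mpr ⟨mem_powersetCard.mpr ⟨hLS.trans hS.1, hL⟩, b, hlt⟩, hLS⟩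
    have hmono : ∃ b, ∃ K ⊆ S, #K = k ∧ IsMono χ b K := by
      rcases exists_isMono_of_two_pow_le_card χ k k S (by
        rw [hS.2, ← two_mul, pow_mul]; norm_num) with h | h
      exacts [⟨_, h⟩, ⟨_, h⟩]
    obtain ⟨b, K, hKS, hK, hm⟩ := hmono
    refine ⟨K, ?_, hKS⟩
    simp only [richCliques, mem_filter, mem_powersetCard]
    exact ⟨⟨⟨subset_univ _, hK⟩, b, hm, fun L hL => hrich b L (hL.trans hKS)⟩, hKS.trans hS.1⟩

/-- If all vertices of `U` have small degree `d` in color `b`, then most `k`-subsets of `U` are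
cliques in the other color. -/
theorem choose_le_two_mul_card_richCliques_of_sparse (χ : Sym2 V → Bool) {k ℓ d : ℕ} {D : ℝ}
    {U : Finset V} {b : Bool} (hk2 : 2 ≤ k) (hU : k ≤ #U)
    (hd : ∀ u ∈ U, #(colorNbrs χ b {u}) ≤ d) (hdU : 2 * d * k ^ 2 + 1 ≤ #U)
    (hD : D ≤ (Fintype.card V : ℝ) - ℓ * (d + 1)) :
    (#U).choose k ≤ 2 * #(richCliques χ k ℓ D) := by
  classical
  let B : Finset (Finset V) := U.biUnion fun u => (colorNbrs χ b {u} ∩ U).image fun w => {w, u}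
  have hBsub : B ⊆ powersetCard 2 U := by
    intro e he
    simp only [B, mem_biUnion, mem_image, mem_inter, colorNbrs, mem_filter, mem_singleton] at he
    obtain ⟨u, hu, w, ⟨⟨-, hwu, -⟩, hw⟩, rfl⟩ := he
    rw [mem_powersetCard]
    exact ⟨by simp [insert_subset_iff, hu, hw], card_pair hwu⟩
  have hBcard : #B ≤ #U * d := card_biUnion_le_card_mul _ _ _ fun u hu =>
    card_image_le.trans ((card_le_card inter_subset_left).trans (hd u hu))
  have hB2 : 2 * #B * k.choose 2 ≤ (#U).choose 2 := by
    have h1 : k.choose 2 * 2 ≤ k ^ 2 := by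
      rw [Nat.choose_two_right]
      refine (Nat.div_mul_le_self _ _).trans ?_
      rw [pow_two]; gcongr; omega
    have h2 : (#U).choose 2 * 2 = #U * (#U - 1) := by
      rw [Nat.choose_two_right, Nat.div_mul_cancel (Nat.even_mul_pred_self _).two_dvd]
    have h3 : 2 * d * k ^ 2 ≤ #U - 1 := by omega
    have h4 : #U * (2 * d * k ^ 2) ≤ #U * (#U - 1) := Nat.mul_le_mul_left _ h3
    have h5 : 2 * #B * (k.choose 2 * 2) ≤ 2 * (#U * d) * k ^ 2 := by gcongr
    nlinarith
  have key := choose_le_two_mul_choose_mul_card hk2 le_rfl hU hBsub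
    (G := {K ∈ richCliques χ k ℓ D | K ⊆ U}) (fun K hK => by
      simp only [richCliques, mem_filter, mem_powersetCard] at hK ⊢
      exact ⟨hK.2, hK.1.1.2⟩) hB2 (fun S hS => by
      rw [mem_powersetCard] at hS
      refine or_iff_not_imp_left.mpr fun hno => ⟨S, ?_, subset_rfl⟩
      simp only [richCliques, mem_filter, mem_powersetCard]
      refine ⟨⟨⟨subset_univ _, hS.2⟩, !b, fun u hu v hv huv => ?_, fun L hL hLℓ => ?_⟩, hS.1⟩
      · by_contra hne
        refine hno ⟨{u, v}, ?_, by simp [insert_subset_iff, hu, hv]⟩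
        simp only [B, mem_biUnion, mem_image, mem_inter, colorNbrs, mem_filter, mem_singleton]
        refine ⟨v, hS.1 hv, u, ⟨⟨mem_univ _, huv, ?_⟩, hS.1 hu⟩, rfl⟩
        simpa using hne
      · have hcompl : (colorNbrs χ (!b) L)ᶜ ⊆ L.biUnion fun u => insert u (colorNbrs χ b {u}) := by
          intro w hw
          simp only [colorNbrs, compl_filter, mem_filter, mem_univ, true_and, mem_biUnion,
            mem_insert, mem_singleton, forall_eq] at hw ⊢
          by_cases hwL : w ∈ L
          · exact ⟨w, hwL, .inl rfl⟩
          · simp only [hwL, not_false_eq_true, true_and, not_forall] at hw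
            obtain ⟨u, hu, hne⟩ := hw
            refine ⟨u, hu, .inr ⟨fun h => hwL (h ▸ hu), by simpa using hne⟩⟩
        have hc : #((colorNbrs χ (!b) L)ᶜ) ≤ ℓ * (d + 1) := by
          rw [← hLℓ]
          refine (card_le_card hcompl).trans (card_biUnion_le_card_mul _ _ _ fun u hu => ?_)
          exact (card_insert_le _ _).trans (Nat.add_le_add_right (hd u (hS.1 (hL hu))) 1)
        have hsum := card_add_card_compl (colorNbrs χ (!b) L)
        have hc' : (#((colorNbrs χ (!b) L)ᶜ) : ℝ) ≤ ℓ * (d + 1) := by exact_mod_cast hc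
        have hsum' : (#(colorNbrs χ (!b) L) : ℝ) + #((colorNbrs χ (!b) L)ᶜ) = Fintype.card V := by
          exact_mod_cast hsum
        linarith)
  rw [Nat.choose_self, mul_one] at key
  exact key.trans (Nat.mul_le_mul_left _ (card_le_card (filter_subset _ _)))

end

theorem choose_le_pow_mul_of_choose_le {n a m k X : ℕ} (hm : 8 ≤ m) (hk : 2 ≤ k)
    (hka : 2 * k ≤ a) (hna : n ≤ 4 * m ^ (4 * k) * a)
    (h : a.choose k ≤ 2 * (4 ^ k).choose k * X) : n.choose k ≤ m ^ (7 * k ^ 2) * X := by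
  have ha : 0 < a := by omega
  refine Nat.le_of_mul_le_mul_left ?_ (pow_pos ha k)
  have h2 : 2 ≤ m := by omega
  have h4 : 4 ≤ m := by omega
  calc a ^ k * n.choose k ≤ (2 * n) ^ k * a.choose k := pow_mul_choose_le_pow_mul_choose hka
    _ ≤ (2 * (4 * m ^ (4 * k) * a)) ^ k * (2 * (4 ^ k) ^ k * X) := by
        gcongr
        refine h.trans ?_
        gcongr
        exact Nat.choose_le_pow _ _
    _ = a ^ k * (8 ^ k * (m ^ (4 * k)) ^ k * 2 * (4 ^ k) ^ k * X) := by
        rw [show 2 * (4 * m ^ (4 * k) * a) = a * (8 * m ^ (4 * k)) by ring, mul_pow, mul_pow]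
        ring
    _ ≤ a ^ k * (m ^ k * (m ^ (4 * k)) ^ k * m * (m ^ k) ^ k * X) := by gcongr
    _ = a ^ k * (m ^ (k + 4 * k * k + 1 + k * k) * X) := by
        simp only [← pow_mul, ← pow_add, ← pow_succ]
    _ ≤ a ^ k * (m ^ (7 * k ^ 2) * X) := by
        gcongr
        · omega
        · nlinarith

section
variable {V : Type*} [DecidableEq V] [Fintype V]

theorem choose_le_pow_mul_card_richCliques (χ : Sym2 V → Bool) {m k ℓ : ℕ} {δ : ℝ}
    (hm : 8 ≤ m) (hℓ : 2 ≤ ℓ) (hℓk : ℓ ≤ k) (hkm : 8 * k ≤ m) (hδ : 0 < δ) (hδ2 : δ ≤ 1 / 2)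
    (hδm : δ ^ k * (m : ℝ) ^ (11 * k * ℓ) ≤ 1)
    (hn : 8 * 4 ^ k * m ^ (4 * k) ≤ Fintype.card V) :
    (Fintype.card V).choose k ≤
      m ^ (7 * k ^ 2) * #(richCliques χ k ℓ (δ * Fintype.card V)) := by
  classical
  set n := Fintype.card V with hndef
  have hm0 : 0 < m := by omega
  have hk4 : k < 4 ^ k := Nat.lt_pow_self (by norm_num)
  have hmpow : m ≤ m ^ (4 * k) := Nat.le_self_pow (by omega) m
  have hmn : 32 * m ≤ n := by
    refine le_trans ?_ hn
    have : 4 ≤ 4 ^ k := Nat.le_self_pow (by omega) 4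
    gcongr
    omega
  have hn0 : 0 < n := by omega
  let W : Finset V := {u | ∀ b, ((m : ℝ) ^ 2)⁻¹ * n ≤ #(colorNbrs χ b {u})}
  by_cases hW : (n : ℝ) / 2 ≤ #W
  · obtain ⟨A, hA, hpoor⟩ := exists_large_of_few_poorSets χ k ℓ (by positivity) hδ hn0 hW
      (fun u hu => (mem_filter.mp hu).2)
    rw [inv_pow, ← pow_mul, ← hndef, show 2 * (2 * k) = 4 * k by ring] at hA hpoor
    have hnA : n ≤ 4 * m ^ (4 * k) * #A := by
      have : (n : ℝ) ≤ 4 * m ^ (4 * k) * #A := by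
        calc (n : ℝ) = 4 * m ^ (4 * k) * (((m : ℝ) ^ (4 * k))⁻¹ * n / 4) := by field_simp
          _ ≤ _ := by gcongr
      exact_mod_cast this
    have hA4 : 2 * 4 ^ k ≤ #A := by
      refine Nat.le_of_mul_le_mul_left ?_ (by positivity : 0 < 4 * m ^ (4 * k))
      linarith
    have hfew : 2 * #(poorSets χ ℓ (δ * n) A) * (2 * 4 ^ k) ^ ℓ ≤ #A ^ ℓ := by
      have h2 : (8 : ℝ) ≤ m := by exact_mod_cast hm
      have h4 : (4 : ℝ) ≤ m := by linarith
      have hm1 : (1 : ℝ) ≤ m := by linarith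
      have : 2 * (#(poorSets χ ℓ (δ * n) A) : ℝ) * (2 * 4 ^ k) ^ ℓ ≤ #A ^ ℓ := by
        calc 2 * (#(poorSets χ ℓ (δ * n) A) : ℝ) * (2 * 4 ^ k) ^ ℓ
            ≤ 2 * (4 * n ^ ℓ * δ ^ k / ((m : ℝ) ^ (4 * k))⁻¹) * (2 * 4 ^ k) ^ ℓ := by gcongr
          _ ≤ 2 * (4 * (4 * m ^ (4 * k) * #A) ^ ℓ * δ ^ k / ((m : ℝ) ^ (4 * k))⁻¹) *
                (2 * 4 ^ k) ^ ℓ := by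
              gcongr
              exact_mod_cast hnA
          _ = #A ^ ℓ * (δ ^ k * (8 * 8 ^ ℓ * (4 ^ k) ^ ℓ * (m ^ (4 * k)) ^ ℓ * m ^ (4 * k))) := by
              rw [div_inv_eq_mul, show (8 : ℝ) ^ ℓ = 4 ^ ℓ * 2 ^ ℓ by rw [← mul_pow]; norm_num]
              simp only [mul_pow]
              ring
          _ ≤ #A ^ ℓ * (δ ^ k * (m * m ^ ℓ * (m ^ k) ^ ℓ * (m ^ (4 * k)) ^ ℓ * m ^ (4 * k))) := by
              gcongr
          _ = #A ^ ℓ * (δ ^ k * (m : ℝ) ^ (1 + ℓ + k * ℓ + 4 * k * ℓ + 4 * k)) := by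
              simp only [← pow_mul, ← pow_add, ← pow_succ', add_comm 1 ℓ]
          _ ≤ #A ^ ℓ * (δ ^ k * (m : ℝ) ^ (11 * k * ℓ)) := by
              gcongr
              nlinarith
          _ ≤ #A ^ ℓ * 1 := by gcongr
          _ = _ := mul_one _
      exact_mod_cast this
    refine choose_le_pow_mul_of_choose_le hm (hℓ.trans hℓk) (by omega) hnA
      (choose_le_mul_card_richCliques_of_few_poorSets χ hℓk (by omega) ?_)
    refine Nat.le_of_mul_le_mul_left ?_ (by positivity : 0 < (2 * 4 ^ k) ^ ℓ)
    have hApos : 0 < #A ^ ℓ := pow_pos (by omega) _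
    have hch := pow_mul_choose_le_pow_mul_choose (a := #A) (n := 4 ^ k) (k := ℓ) (by omega)
    calc _ = (2 * #(poorSets χ ℓ (δ * n) A) * (2 * 4 ^ k) ^ ℓ) * (4 ^ k).choose ℓ := by ring
      _ ≤ #A ^ ℓ * (4 ^ k).choose ℓ := by gcongr
      _ ≤ _ := hch
  · set d := n / m ^ 2
    have hdm : d * m ^ 2 ≤ n := Nat.div_mul_le_self _ _
    let U : Bool → Finset V := fun b => {u | #(colorNbrs χ b {u}) ≤ d}
    have hcover : (univ : Finset V) ⊆ W ∪ (U true ∪ U false) := by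
      intro u _
      by_cases hu : u ∈ W
      · exact mem_union_left _ hu
      · simp only [W, mem_filter, mem_univ, true_and, not_forall, not_le] at hu
        obtain ⟨b, hb⟩ := hu
        have hUb : u ∈ U b := by
          simp only [U, mem_filter, mem_univ, true_and]
          rw [Nat.le_div_iff_mul_le (by positivity)]
          rw [inv_mul_eq_div, lt_div_iff₀ (by positivity)] at hb
          exact_mod_cast hb.le
        cases b <;> simp [hUb]
    obtain ⟨b, hb⟩ : ∃ b, n ≤ 4 * #(U b) := by
      by_contra! hcon
      have h1 := card_le_card hcover
      have h2 := card_union_le W (U true ∪ U false)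
      have h3 := card_union_le (U true) (U false)
      rw [card_univ, ← hndef] at h1
      have h4 : 2 * #W < n := by
        have : 2 * (#W : ℝ) < n := by linarith
        exact_mod_cast this
      have := hcon true
      have := hcon false
      omega
    have hdk : 64 * (d * k ^ 2) ≤ n := by
      calc 64 * (d * k ^ 2) = d * (8 * k) ^ 2 := by ring
        _ ≤ d * m ^ 2 := by gcongr
        _ ≤ n := hdm
    have hℓd : 64 * (ℓ * d) ≤ n := by
      refine le_trans ?_ hdk
      have : ℓ ≤ k ^ 2 := by nlinarith
      rw [mul_comm ℓ d]
      gcongr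
    have hD : δ * n ≤ (n : ℝ) - ℓ * (d + 1) := by
      have h1 : 64 * ((ℓ : ℝ) * d) ≤ n := by exact_mod_cast hℓd
      have h2 : 8 * (ℓ : ℝ) ≤ n := by
        have : 8 * ℓ ≤ n := by omega
        exact_mod_cast this
      have h3 : δ * n ≤ 1 / 2 * n := by gcongr
      linarith
    have hX := choose_le_two_mul_card_richCliques_of_sparse χ (hℓ.trans hℓk) (by omega)
      (fun u hu => (mem_filter.mp hu).2 : ∀ u ∈ U b, #(colorNbrs χ b {u}) ≤ d)
      (by rw [mul_assoc]; omega) hD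
    refine choose_le_pow_mul_of_choose_le hm (hℓ.trans hℓk) (by omega) (hb.trans ?_)
      (hX.trans ?_)
    · have : 1 ≤ m ^ (4 * k) := Nat.one_le_pow _ _ hm0
      gcongr
      omega
    · have : 1 ≤ (4 ^ k).choose k := Nat.choose_pos hk4.le
      gcongr
      omega

end

/-- For all sufficiently large `m` and sufficiently large `n`: every red/blue coloring of
`K_n` contains at least `2^{-50 m^{4/3} log m} C(n, ⌈m^{2/3}⌉)` monochromatic cliques `K` of
order `⌈m^{2/3}⌉` such that every subset `L` of `K` of size `⌈2 m^{1/3}⌉` has at least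
`2^{-50 m^{1/3} log m} n` vertices joined to every element of `L` in the color of `K`
(logs base 2). -/
theorem dependent_random_choice_cliques :
    ∃ M : ℕ, ∀ m : ℕ, M ≤ m → ∃ N : ℕ, ∀ n : ℕ, N ≤ n →
      ∀ χ : Sym2 (Fin n) → Bool,
        (2 : ℝ) ^ (-(50 * (m : ℝ) ^ ((4 : ℝ) / 3) * Real.logb 2 (m : ℝ))) *
            (n.choose ⌈(m : ℝ) ^ ((2 : ℝ) / 3)⌉₊ : ℝ) ≤
          ({K : Finset (Fin n) | ∃ b : Bool,
              K.card = ⌈(m : ℝ) ^ ((2 : ℝ) / 3)⌉₊ ∧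
              (∀ u ∈ K, ∀ v ∈ K, u ≠ v → χ s(u, v) = b) ∧
              ∀ L ⊆ K, L.card = ⌈2 * (m : ℝ) ^ ((1 : ℝ) / 3)⌉₊ →
                (2 : ℝ) ^ (-(50 * (m : ℝ) ^ ((1 : ℝ) / 3) * Real.logb 2 (m : ℝ))) *
                    (n : ℝ) ≤
                  ({w : Fin n | w ∉ L ∧ ∀ u ∈ L, χ s(w, u) = b}.ncard : ℝ)}.ncard : ℝ) := by
  refine ⟨4096, fun m hM => ?_⟩
  have hmR : (4096 : ℝ) ≤ m := by exact_mod_cast hM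
  have hm0 : (0 : ℝ) < m := by linarith
  have hm1 : (1 : ℝ) ≤ m := by linarith
  set t : ℝ := (m : ℝ) ^ ((1 : ℝ) / 3) with ht
  have ht2 : (m : ℝ) ^ ((2 : ℝ) / 3) = t ^ 2 := by
    rw [ht, ← Real.rpow_natCast, ← Real.rpow_mul hm0.le]; norm_num
  have ht3 : (m : ℝ) = t ^ 3 := by
    rw [ht, ← Real.rpow_natCast, ← Real.rpow_mul hm0.le]; norm_num
  have ht4 : (m : ℝ) ^ ((4 : ℝ) / 3) = t ^ 4 := by
    rw [ht, ← Real.rpow_natCast, ← Real.rpow_mul hm0.le]; norm_num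
  have ht0 : 0 ≤ t := by positivity
  have ht16 : 16 ≤ t := by
    refine le_of_pow_le_pow_left₀ (n := 3) (by norm_num) ht0 ?_
    rw [← ht3]; linarith
  have hbase : ∀ x : ℝ, (2 : ℝ) ^ (-(50 * x * Real.logb 2 m)) = (m : ℝ) ^ (-(50 * x)) := by
    intro x
    rw [show -(50 * x * Real.logb 2 m) = Real.logb 2 m * -(50 * x) by ring,
      Real.rpow_mul (by norm_num), Real.rpow_logb (by norm_num) (by norm_num) hm0]
  rw [ht2, ht4, hbase, hbase]
  set k := ⌈t ^ 2⌉₊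
  set ℓ := ⌈2 * t⌉₊
  set δ : ℝ := (m : ℝ) ^ (-(50 * t))
  have hk1 : t ^ 2 ≤ k := Nat.le_ceil _
  have hk2 : (k : ℝ) < t ^ 2 + 1 := Nat.ceil_lt_add_one (by positivity)
  have hℓ1 : 2 * t ≤ ℓ := Nat.le_ceil _
  have hℓ2 : (ℓ : ℝ) < 2 * t + 1 := Nat.ceil_lt_add_one (by positivity)
  have hℓ : 2 ≤ ℓ := by
    have : (2 : ℝ) ≤ ℓ := by linarith
    exact_mod_cast this
  have hℓk : ℓ ≤ k := by
    have : (ℓ : ℝ) ≤ k := by nlinarith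
    exact_mod_cast this
  have hkm : 8 * k ≤ m := by
    have : 8 * (k : ℝ) ≤ m := by
      have : 16 * t ^ 2 ≤ t ^ 3 := by nlinarith [sq_nonneg t]
      rw [ht3]
      nlinarith
    exact_mod_cast this
  have hδ2 : δ ≤ 1 / 2 := by
    calc δ ≤ (m : ℝ) ^ (-1 : ℝ) := Real.rpow_le_rpow_of_exponent_le hm1 (by linarith)
      _ = (m : ℝ)⁻¹ := Real.rpow_neg_one _
      _ ≤ 2⁻¹ := by gcongr; linarith
      _ = 1 / 2 := by norm_num
  have hδm : δ ^ k * (m : ℝ) ^ (11 * k * ℓ) ≤ 1 := by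
    rw [← Real.rpow_natCast, ← Real.rpow_natCast, ← Real.rpow_mul hm0.le, ← Real.rpow_add hm0]
    refine Real.rpow_le_one_of_one_le_of_nonpos hm1 ?_
    push_cast
    nlinarith
  refine ⟨8 * 4 ^ k * m ^ (4 * k), fun n hn χ => ?_⟩
  have hmain := choose_le_pow_mul_card_richCliques χ (by omega) hℓ hℓk hkm
    (by positivity : 0 < δ) hδ2 hδm (by simpa using hn)
  rw [Fintype.card_fin] at hmain
  have hset : {K : Finset (Fin n) | ∃ b : Bool, #K = k ∧
      (∀ u ∈ K, ∀ v ∈ K, u ≠ v → χ s(u, v) = b) ∧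
      ∀ L ⊆ K, #L = ℓ →
        δ * (n : ℝ) ≤ ({w : Fin n | w ∉ L ∧ ∀ u ∈ L, χ s(w, u) = b}.ncard : ℝ)} =
      richCliques χ k ℓ (δ * n) := by
    have hnbr : ∀ (b : Bool) (L : Finset (Fin n)),
        {w : Fin n | w ∉ L ∧ ∀ u ∈ L, χ s(w, u) = b}.ncard = #(colorNbrs χ b L) := by
      intro b L
      rw [← Set.ncard_coe_finset]
      simp [colorNbrs]
    ext K
    simp [hnbr, richCliques, IsMono]
  rw [hset, Set.ncard_coe_finset]
  have hmainR : (n.choose k : ℝ) ≤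
      (m : ℝ) ^ (7 * k ^ 2) * #(richCliques χ k ℓ (δ * n)) := by exact_mod_cast hmain
  have hpow : (m : ℝ) ^ (-(50 * t ^ 4)) * (m : ℝ) ^ (7 * k ^ 2) ≤ 1 := by
    rw [← Real.rpow_natCast (m : ℝ), ← Real.rpow_add hm0]
    refine Real.rpow_le_one_of_one_le_of_nonpos hm1 ?_
    push_cast
    have : (k : ℝ) ^ 2 ≤ (2 * t ^ 2) ^ 2 := by gcongr; nlinarith
    nlinarith [sq_nonneg (t ^ 2)]
  calc (m : ℝ) ^ (-(50 * t ^ 4)) * (n.choose k : ℝ)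
      ≤ (m : ℝ) ^ (-(50 * t ^ 4)) *
          ((m : ℝ) ^ (7 * k ^ 2) * #(richCliques χ k ℓ (δ * n))) :=
        mul_le_mul_of_nonneg_left hmainR (by positivity)
    _ = (m : ℝ) ^ (-(50 * t ^ 4)) * (m : ℝ) ^ (7 * k ^ 2) *
          #(richCliques χ k ℓ (δ * n)) := by ring
    _ ≤ 1 * #(richCliques χ k ℓ (δ * n)) :=
        mul_le_mul_of_nonneg_right hpow (Nat.cast_nonneg _)
    _ = _ := one_mul _
end
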